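/- Assume the generalized Riemann hypothesis for Dirichlet L-functions. Let χ be a primitive Dirichlet character modulo q with q > 1. Then there exists an absolute constant C (independent of q and χ) such that for all t ≥ 2, |S(t,χ)| < 0.804 · (log(q(t+1)) / log log(q(t+3))) + C · (log(q(t+3)) / (log log(q(t+3)))²). -/

import Mathlib

open Complex Real MeasureTheory

/-- The generalized Riemann hypothesis for the Dirichlet L-function of `χ`:
every nontrivial zero has real part `1/2`. -/
def GRH {q : ℕ} [NeZero q] (χ : DirichletCharacter ℂ q) : Prop :=
  ∀ ρ : ℂ, DirichletCharacter.LFunction χ ρ = 0 → 0 < ρ.re → ρ.re < 1 → ρ.re = 1 / 2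

/-- `S(t,χ) = -(1/π) ∫_{1/2}^∞ Im (L'/L)(σ+it,χ) dσ`. -/
noncomputable def argS {q : ℕ} [NeZero q] (χ : DirichletCharacter ℂ q) (t : ℝ) : ℝ :=
  -(1 / π) * ∫ σ in Set.Ioi (1 / 2 : ℝ),
    (logDeriv (DirichletCharacter.LFunction χ) (σ + t * Complex.I)).im

section

open Filter Topology Set

lemma integrable_decay : Integrable fun y : ℝ => (1 + |y|) ^ (-(3 / 2) : ℝ) := by
  have := integrable_one_add_norm (E := ℝ) (μ := volume) (r := 3 / 2) (by simp; norm_num)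
  simpa using this

lemma decay_le_of_abs_le {z : ℂ} {y : ℝ} (h : |y| ≤ ‖z‖) :
    (1 + ‖z‖) ^ (-(3 / 2) : ℝ) ≤ (1 + |y|) ^ (-(3 / 2) : ℝ) :=
  Real.rpow_le_rpow_of_nonpos (by positivity) (by linarith) (by norm_num)

lemma abs_le_norm_add_mul_I (x y : ℝ) : |y| ≤ ‖(x + y * I : ℂ)‖ := by
  simpa using abs_im_le_norm (x + y * I : ℂ)

/-- The integrals of a decaying holomorphic function over the two sides of a vertical strip agree. -/
theorem integral_vertical_eq_of_strip {f : ℂ → ℂ} {c C : ℝ} (hc : 0 ≤ c)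
    (hf : ∀ z : ℂ, 0 ≤ z.re → z.re ≤ c → DifferentiableAt ℂ f z)
    (hb : ∀ z : ℂ, 0 ≤ z.re → z.re ≤ c → ‖f z‖ ≤ C * (1 + ‖z‖) ^ (-(3 / 2) : ℝ)) :
    ∫ y : ℝ, f (c + y * I) = ∫ y : ℝ, f (y * I) := by
  have hC : 0 ≤ C := by
    have := (norm_nonneg _).trans (hb 0 le_rfl hc)
    simpa using this
  have hint_f : ∀ x : ℝ, 0 ≤ x → x ≤ c → Integrable fun y : ℝ => f (x + y * I) := by
    intro x h0 h1
    refine (integrable_decay.const_mul C).mono' ?_ (Eventually.of_forall fun y => ?_)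
    · have : Continuous fun y : ℝ => f (x + y * I) := by
        refine continuous_iff_continuousAt.2 fun y => ?_
        have h := (hf (x + y * I) (by simpa) (by simpa)).continuousAt
        exact ContinuousAt.comp (g := f) (f := fun y : ℝ => (x + y * I : ℂ)) h (by fun_prop)
      exact this.aestronglyMeasurable
    · refine (hb _ (by simpa) (by simpa)).trans ?_
      gcongr ?_ * ?_
      exact decay_le_of_abs_le (abs_le_norm_add_mul_I x y)
  have hrect : ∀ T : ℝ, (∫ y in (-T)..T, f (c + y * I)) - ∫ y in (-T)..T, f (y * I) =
      I * ((∫ x in (0 : ℝ)..c, f (x + (-T : ℝ) * I)) - ∫ x in (0 : ℝ)..c, f (x + T * I)) := by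
    intro T
    have := Complex.integral_boundary_rect_eq_zero_of_differentiableOn f (⟨0, -T⟩ : ℂ) ⟨c, T⟩ (by
      intro z hz
      simp only [mem_reProdIm, uIcc_of_le hc] at hz
      exact (hf z hz.1.1 hz.1.2).differentiableWithinAt)
    simp only [smul_eq_mul, ofReal_zero, zero_add] at this
    linear_combination (-I) * this + ((∫ y in (-T)..T, f (c + y * I)) - ∫ y in (-T)..T, f (y * I)) * I_sq
  have hlim : Tendsto (fun T : ℝ => (∫ y in (-T)..T, f (c + y * I)) - ∫ y in (-T)..T, f (y * I)) atTop
      (𝓝 ((∫ y : ℝ, f (c + y * I)) - ∫ y : ℝ, f (y * I))) := by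
    refine Tendsto.sub ?_ ?_
    · exact intervalIntegral_tendsto_integral (hint_f c hc le_rfl) tendsto_neg_atTop_atBot tendsto_id
    · have := hint_f 0 le_rfl hc
      simp only [ofReal_zero, zero_add] at this
      exact intervalIntegral_tendsto_integral this tendsto_neg_atTop_atBot tendsto_id
  have hz : Tendsto (fun T : ℝ => (∫ y in (-T)..T, f (c + y * I)) - ∫ y in (-T)..T, f (y * I)) atTop
      (𝓝 0) := by
    have hside : ∀ T : ℝ, ‖∫ x in (0 : ℝ)..c, f (x + T * I)‖ ≤ C * (1 + |T|) ^ (-(3 / 2) : ℝ) * c := by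
      intro T
      have := intervalIntegral.norm_integral_le_of_norm_le_const (a := (0 : ℝ)) (b := c)
        (f := fun x : ℝ => f (x + T * I)) (C := C * (1 + |T|) ^ (-(3 / 2) : ℝ)) (by
          intro x hx
          rw [uIoc_of_le hc] at hx
          refine (hb _ (by simpa using hx.1.le) (by simpa using hx.2)).trans ?_
          gcongr ?_ * ?_
          exact decay_le_of_abs_le (abs_le_norm_add_mul_I x T))
      simpa [abs_of_nonneg hc] using this
    refine squeeze_zero_norm (a := fun T : ℝ => 2 * (C * (1 + |T|) ^ (-(3 / 2) : ℝ) * c)) ?_ ?_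
    · intro T
      rw [hrect, norm_mul, norm_I, one_mul]
      refine (norm_sub_le _ _).trans ?_
      have h1 := hside (-T)
      have h2 := hside T
      rw [abs_neg] at h1
      linarith
    · have : Tendsto (fun T : ℝ => (1 + |T|) ^ (-(3 / 2) : ℝ)) atTop (𝓝 0) :=
        (tendsto_rpow_neg_atTop (by norm_num)).comp
          (tendsto_atTop_add_const_left _ _ tendsto_abs_atTop_atTop)
      simpa using ((this.const_mul C).mul_const c).const_mul 2
  exact sub_eq_zero.1 (tendsto_nhds_unique hlim hz)

/-- The integral over the boundary of a half-plane of a decaying holomorphic function vanishes. -/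
theorem integral_vertical_eq_zero {f : ℂ → ℂ} {C : ℝ}
    (hf : ∀ z : ℂ, 0 ≤ z.re → DifferentiableAt ℂ f z)
    (hb : ∀ z : ℂ, 0 ≤ z.re → ‖f z‖ ≤ C * (1 + ‖z‖) ^ (-(3 / 2) : ℝ)) :
    ∫ y : ℝ, f (y * I) = 0 := by
  have hC : 0 ≤ C := by
    have := (norm_nonneg _).trans (hb 0 le_rfl)
    simpa using this
  have hconst : ∀ᶠ c : ℝ in atTop, ∫ y : ℝ, f (c + y * I) = ∫ y : ℝ, f (y * I) := by
    filter_upwards [eventually_ge_atTop 0] with c hc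
    exact integral_vertical_eq_of_strip hc (fun z h _ => hf z h) (fun z h _ => hb z h)
  have hlim : Tendsto (fun c : ℝ => ∫ y : ℝ, f (c + y * I)) atTop (𝓝 (∫ y : ℝ, (0 : ℂ))) := by
    refine tendsto_integral_filter_of_dominated_convergence
      (fun y => C * (1 + |y|) ^ (-(3 / 2) : ℝ)) ?_ ?_ (integrable_decay.const_mul C) ?_
    · filter_upwards [eventually_ge_atTop 0] with c hc
      have : Continuous fun y : ℝ => f (c + y * I) := by
        refine continuous_iff_continuousAt.2 fun y => ?_
        have h := (hf (c + y * I) (by simpa)).continuousAt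
        exact ContinuousAt.comp (g := f) (f := fun y : ℝ => (c + y * I : ℂ)) h (by fun_prop)
      exact this.aestronglyMeasurable
    · filter_upwards [eventually_ge_atTop 0] with c hc
      refine Eventually.of_forall fun y => (hb _ (by simpa)).trans ?_
      gcongr ?_ * ?_
      exact decay_le_of_abs_le (abs_le_norm_add_mul_I c y)
    · refine Eventually.of_forall fun y => ?_
      refine squeeze_zero_norm' (a := fun c : ℝ => C * (1 + |c|) ^ (-(3 / 2) : ℝ)) ?_ ?_
      · filter_upwards [eventually_ge_atTop 0] with c hc
        refine (hb _ (by simpa)).trans ?_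
        gcongr ?_ * ?_
        exact decay_le_of_abs_le (by simpa using abs_re_le_norm (c + y * I : ℂ))
      · have : Tendsto (fun T : ℝ => (1 + |T|) ^ (-(3 / 2) : ℝ)) atTop (𝓝 0) :=
          (tendsto_rpow_neg_atTop (by norm_num)).comp
            (tendsto_atTop_add_const_left _ _ tendsto_abs_atTop_atTop)
        simpa using this.const_mul C
  have h2 := hlim.congr' hconst
  simpa using tendsto_nhds_unique tendsto_const_nhds h2

/-- A divided difference of a function of moderate growth, divided by one more linear factor. -/
theorem dslope_div_decay {S : Set ℂ} (hS : IsClosed S) {b : ℝ} (hb : 0 < b) (hbS : S ∈ 𝓝 (b : ℂ))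
    (hre : ∀ z ∈ S, 0 ≤ z.re) {h : ℂ → ℂ} {C : ℝ} (hd : ∀ z ∈ S, DifferentiableAt ℂ h z)
    (hC : ∀ z ∈ S, ‖h z‖ ≤ C * (1 + ‖z‖) ^ (1 / 2 : ℝ)) :
    ∃ C' : ℝ, ∀ z ∈ S, DifferentiableAt ℂ (fun v => dslope h b v / (v + b)) z ∧
      ‖dslope h b z / (z + b)‖ ≤ C' * (1 + ‖z‖) ^ (-(3 / 2) : ℝ) := by
  have hne : ∀ z ∈ S, z + b ≠ 0 := by
    intro z hz h0
    have := congrArg re h0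
    simp at this
    linarith [hre z hz]
  have hdiff : ∀ z ∈ S, DifferentiableAt ℂ (fun v => dslope h b v / (v + b)) z := by
    intro z hz
    refine DifferentiableAt.div ?_ (by fun_prop) (hne z hz)
    by_cases hzb : z = b
    · subst hzb
      have : DifferentiableOn ℂ (dslope h b) S :=
        (Complex.differentiableOn_dslope hbS).2 fun w hw => (hd w hw).differentiableWithinAt
      exact this.differentiableAt hbS
    · exact (differentiableAt_dslope_of_ne hzb).2 (hd z hz)
  have hcpt : IsCompact (S ∩ Metric.closedBall 0 (2 * b + 1)) :=
    (isCompact_closedBall _ _).inter_left hS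
  obtain ⟨D, hD⟩ := hcpt.exists_bound_of_continuousOn
    (f := fun v => dslope h b v / (v + b))
    (fun z hz => (hdiff z hz.1).continuousAt.continuousWithinAt)
  have hbmem : (b : ℂ) ∈ S := mem_of_mem_nhds hbS
  have hC0 : 0 ≤ C := by
    have := (norm_nonneg _).trans (hC b hbmem)
    exact nonneg_of_mul_nonneg_left this (by positivity)
  refine ⟨|D| * (2 * b + 2) ^ (3 / 2 : ℝ) + 4 * (C + ‖h b‖), fun z hz => ⟨hdiff z hz, ?_⟩⟩
  have hp : 0 < (1 + ‖z‖) ^ (-(3 / 2) : ℝ) := by positivity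
  by_cases hzl : ‖z‖ ≤ 2 * b + 1
  · have h1 := hD z ⟨hz, by simpa using hzl⟩
    have h2 : 1 ≤ (2 * b + 2) ^ (3 / 2 : ℝ) * (1 + ‖z‖) ^ (-(3 / 2) : ℝ) := by
      rw [Real.rpow_neg (by positivity), ← div_eq_mul_inv, ← Real.div_rpow (by positivity) (by positivity)]
      refine Real.one_le_rpow ?_ (by norm_num)
      rw [le_div_iff₀ (by positivity)]
      linarith
    calc ‖dslope h b z / (z + b)‖ ≤ |D| * 1 := by simpa using h1.trans (le_abs_self D)
      _ ≤ |D| * ((2 * b + 2) ^ (3 / 2 : ℝ) * (1 + ‖z‖) ^ (-(3 / 2) : ℝ)) := by gcongr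
      _ ≤ _ := by
        rw [add_mul, mul_assoc]
        exact le_add_of_nonneg_right (by positivity)
  · push Not at hzl
    have hzb : z ≠ b := by
      rintro rfl
      simp [abs_of_pos hb] at hzl
      linarith
    have h1 : (1 + ‖z‖) / 2 ≤ ‖z - b‖ := by
      have := norm_sub_norm_le z (b : ℂ)
      rw [norm_real, Real.norm_of_nonneg hb.le] at this
      linarith
    have h2 : (1 + ‖z‖) / 2 ≤ ‖z + b‖ := by
      have := norm_sub_norm_le z (-(b : ℂ))
      rw [norm_neg, norm_real, Real.norm_of_nonneg hb.le, sub_neg_eq_add] at this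
      linarith
    have h3 : ‖h z - h b‖ ≤ (C + ‖h b‖) * (1 + ‖z‖) ^ (1 / 2 : ℝ) := by
      have h4 : 1 ≤ (1 + ‖z‖) ^ (1 / 2 : ℝ) :=
        Real.one_le_rpow (by linarith [norm_nonneg z]) (by norm_num)
      have := norm_sub_le (h z) (h b)
      have := hC z hz
      nlinarith [norm_nonneg (h b)]
    rw [dslope_of_ne _ hzb, slope_def_field, norm_div, norm_div]
    calc ‖h z - h b‖ / ‖z - b‖ / ‖z + b‖
        ≤ (C + ‖h b‖) * (1 + ‖z‖) ^ (1 / 2 : ℝ) / ((1 + ‖z‖) / 2) / ((1 + ‖z‖) / 2) := by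
          gcongr
      _ = 4 * (C + ‖h b‖) * (1 + ‖z‖) ^ (-(3 / 2) : ℝ) := by
          have : (1 + ‖z‖) ^ (1 / 2 : ℝ) = (1 + ‖z‖) ^ (-(3 / 2) : ℝ) * (1 + ‖z‖) ^ 2 := by
            rw [← Real.rpow_natCast, ← Real.rpow_add (by positivity)]
            norm_num
          rw [this]
          field_simp
          norm_num
      _ ≤ _ := by
          gcongr
          exact le_add_of_nonneg_left (by positivity)

/-- The Poisson kernel of the right half-plane. -/
noncomputable def poissonKer (b y : ℝ) : ℝ := b / (π * (b ^ 2 + y ^ 2))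

lemma poissonKer_nonneg {b : ℝ} (hb : 0 < b) (y : ℝ) : 0 ≤ poissonKer b y := by
  unfold poissonKer; positivity

lemma continuous_poissonKer {b : ℝ} (hb : 0 < b) : Continuous (poissonKer b) := by
  unfold poissonKer
  refine Continuous.div (by fun_prop) (by fun_prop) fun y => ?_
  positivity

lemma poissonKer_eq_smul {b : ℝ} (hb : 0 < b) (y : ℝ) :
    poissonKer b y = (π * b)⁻¹ * (1 + (y / b) ^ 2)⁻¹ := by
  have := hb.ne'
  unfold poissonKer
  field_simp

lemma integrable_poissonKer {b : ℝ} (hb : 0 < b) : Integrable (poissonKer b) := by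
  have := (integrable_inv_one_add_sq.comp_div hb.ne').const_mul (π * b)⁻¹
  refine this.congr (Eventually.of_forall fun y => ?_)
  exact (poissonKer_eq_smul hb y).symm

lemma integral_poissonKer {b : ℝ} (hb : 0 < b) : ∫ y, poissonKer b y = 1 := by
  simp_rw [poissonKer_eq_smul hb]
  rw [integral_const_mul, Measure.integral_comp_div (fun y => (1 + y ^ 2)⁻¹) b,
    integral_univ_inv_one_add_sq, abs_of_pos hb]
  have := hb.ne'
  simp
  field_simp

/-- Holomorphic on the closed right half-plane, with growth of order at most one half. -/
def TameOn (h : ℂ → ℂ) : Prop :=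
  (∀ z : ℂ, 0 ≤ z.re → DifferentiableAt ℂ h z) ∧
    ∃ C : ℝ, ∀ z : ℂ, 0 ≤ z.re → ‖h z‖ ≤ C * (1 + ‖z‖) ^ (1 / 2 : ℝ)

lemma TameOn.add {f g : ℂ → ℂ} (hf : TameOn f) (hg : TameOn g) : TameOn fun z => f z + g z := by
  obtain ⟨hf, C, hC⟩ := hf
  obtain ⟨hg, D, hD⟩ := hg
  refine ⟨fun z hz => (hf z hz).add (hg z hz), C + D, fun z hz => (norm_add_le _ _).trans ?_⟩
  rw [add_mul]
  exact add_le_add (hC z hz) (hD z hz)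

lemma TameOn.const (c : ℂ) : TameOn fun _ => c := by
  refine ⟨fun z _ => by fun_prop, ‖c‖, fun z _ => ?_⟩
  exact le_mul_of_one_le_right (norm_nonneg _)
    (Real.one_le_rpow (by linarith [norm_nonneg z]) (by norm_num))

lemma TameOn.mul_exp {h : ℂ → ℂ} (hh : TameOn h) {u : ℝ} (hu : 0 ≤ u) :
    TameOn fun z => h z * cexp (-(u * z)) := by
  obtain ⟨hd, C, hC⟩ := hh
  refine ⟨fun z hz => (hd z hz).mul (by fun_prop), C, fun z hz => ?_⟩
  rw [norm_mul, norm_exp]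
  refine le_trans (mul_le_of_le_one_right (norm_nonneg _) ?_) (hC z hz)
  simp only [neg_re, mul_re, ofReal_re, ofReal_im, zero_mul, sub_zero]
  exact Real.exp_le_one_iff.2 (by have := mul_nonneg hu hz; linarith)

lemma TameOn.continuous {h : ℂ → ℂ} (hh : TameOn h) : Continuous fun y : ℝ => h (y * I) := by
  refine continuous_iff_continuousAt.2 fun y => ?_
  have h0 := (hh.1 (y * I) (by simp)).continuousAt
  exact ContinuousAt.comp (g := h) (f := fun y : ℝ => (y * I : ℂ)) h0 (by fun_prop)

lemma continuous_div_decay {b : ℝ} (hb : 0 < b) : ∃ K : ℝ, 0 ≤ K ∧ ∀ y : ℝ,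
    (b ^ 2 + y ^ 2)⁻¹ * (1 + |y|) ^ (1 / 2 : ℝ) ≤ K * (1 + |y|) ^ (-(3 / 2) : ℝ) := by
  refine ⟨2 * (1 + 1 / b ^ 2), by positivity, fun y => ?_⟩
  have h1 : (1 + |y|) ^ 2 ≤ 2 * (1 + 1 / b ^ 2) * (b ^ 2 + y ^ 2) := by
    have : 2 * (1 + 1 / b ^ 2) * (b ^ 2 + y ^ 2) = 2 * (1 + y ^ 2) + 2 * (b ^ 2 + y ^ 2 / b ^ 2) := by
      field_simp
      ring
    rw [this]
    have : 0 ≤ 2 * (b ^ 2 + y ^ 2 / b ^ 2) := by positivity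
    nlinarith [sq_abs y, sq_nonneg (1 - |y|)]
  have : (1 + |y|) ^ (1 / 2 : ℝ) = (1 + |y|) ^ (-(3 / 2) : ℝ) * (1 + |y|) ^ 2 := by
    rw [← Real.rpow_natCast, ← Real.rpow_add (by positivity)]
    norm_num
  rw [this, inv_mul_le_iff₀ (by positivity)]
  have : 0 < (1 + |y|) ^ (-(3 / 2) : ℝ) := by positivity
  nlinarith

lemma integrable_of_growth {b : ℝ} (hb : 0 < b) {φ k : ℝ → ℂ} (hφ : Continuous φ)
    (hk : Continuous k) {C D : ℝ} (hC : ∀ y, ‖φ y‖ ≤ C * (1 + |y|) ^ (1 / 2 : ℝ))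
    (hD : ∀ y, ‖k y‖ ≤ D * (b ^ 2 + y ^ 2)⁻¹) : Integrable fun y => k y * φ y := by
  obtain ⟨K, hK0, hK⟩ := continuous_div_decay hb
  have hC0 : 0 ≤ C := by
    have := (norm_nonneg _).trans (hC 0)
    simpa using this
  have hD0 : 0 ≤ D := by
    have := (norm_nonneg _).trans (hD 0)
    exact nonneg_of_mul_nonneg_left this (by positivity)
  refine (integrable_decay.const_mul (D * C * K)).mono' (hk.mul hφ).aestronglyMeasurable
    (Eventually.of_forall fun y => ?_)
  rw [norm_mul]
  calc ‖k y‖ * ‖φ y‖ ≤ (D * (b ^ 2 + y ^ 2)⁻¹) * (C * (1 + |y|) ^ (1 / 2 : ℝ)) := by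
        gcongr
        · exact hD y
        · exact hC y
    _ = D * C * ((b ^ 2 + y ^ 2)⁻¹ * (1 + |y|) ^ (1 / 2 : ℝ)) := by ring
    _ ≤ D * C * (K * (1 + |y|) ^ (-(3 / 2) : ℝ)) :=
        mul_le_mul_of_nonneg_left (hK y) (by positivity)
    _ = _ := by ring

lemma TameOn.integrable_mul {h : ℂ → ℂ} (hh : TameOn h) {b : ℝ} (hb : 0 < b) {k : ℝ → ℂ}
    (hk : Continuous k) {D : ℝ} (hD : ∀ y, ‖k y‖ ≤ D * (b ^ 2 + y ^ 2)⁻¹) :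
    Integrable fun y : ℝ => k y * h (y * I) := by
  obtain ⟨C, hC⟩ := hh.2
  refine integrable_of_growth hb hh.continuous hk (C := C) (fun y => ?_) hD
  simpa using hC (y * I) (by simp)

lemma norm_poissonKer {b : ℝ} (hb : 0 < b) (y : ℝ) :
    ‖(poissonKer b y : ℂ)‖ ≤ b / π * (b ^ 2 + y ^ 2)⁻¹ := by
  rw [norm_real, Real.norm_of_nonneg (poissonKer_nonneg hb y)]
  unfold poissonKer
  apply le_of_eq
  field_simp

lemma TameOn.integrable {h : ℂ → ℂ} (hh : TameOn h) {b : ℝ} (hb : 0 < b) :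
    Integrable fun y : ℝ => (poissonKer b y : ℂ) * h (y * I) :=
  hh.integrable_mul hb (continuous_ofReal.comp (continuous_poissonKer hb)) (norm_poissonKer hb)

lemma poissonKer_mul_sub {h : ℂ → ℂ} {b : ℝ} (hb : 0 < b) (y : ℝ) :
    dslope h b (y * I) / (y * I + b) =
      -(π / b : ℝ) * ((poissonKer b y : ℂ) * h (y * I) - (poissonKer b y : ℂ) * h b) := by
  have h1 : (y * I - b : ℂ) ≠ 0 := by
    intro h0
    have := congrArg re h0
    simp at this
    exact hb.ne' this
  have h2 : (y * I + b : ℂ) ≠ 0 := by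
    intro h0
    have := congrArg re h0
    simp at this
    exact hb.ne' this
  have h3 : (y * I : ℂ) ≠ b := sub_ne_zero.1 h1
  have h4 : (b : ℂ) ≠ 0 := by exact_mod_cast hb.ne'
  have h5 : (π : ℂ) ≠ 0 := by exact_mod_cast pi_ne_zero
  have h6 : (b ^ 2 + y ^ 2 : ℂ) ≠ 0 := by
    have : b ^ 2 + y ^ 2 ≠ 0 := by positivity
    exact_mod_cast this
  rw [dslope_of_ne _ h3, slope_def_field]
  unfold poissonKer
  push_cast
  field_simp
  linear_combination (h (y * I) - h b) * y ^ 2 * I_sq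

theorem TameOn.poisson {h : ℂ → ℂ} (hh : TameOn h) {b : ℝ} (hb : 0 < b) :
    ∫ y : ℝ, (poissonKer b y : ℂ) * h (y * I) = h b := by
  obtain ⟨C, hC⟩ := hh.2
  obtain ⟨C', hC'⟩ := dslope_div_decay (S := {z : ℂ | 0 ≤ z.re})
    (isClosed_le continuous_const continuous_re) hb
    (mem_of_superset ((isOpen_lt continuous_const continuous_re).mem_nhds
      (show (0 : ℝ) < (b : ℂ).re by simpa)) fun z (hz : 0 < z.re) => hz.le)
    (fun z hz => hz) hh.1 hC
  have h0 := integral_vertical_eq_zero (fun z hz => (hC' z hz).1) (fun z hz => (hC' z hz).2)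
  simp_rw [poissonKer_mul_sub hb] at h0
  have hi : Integrable fun y => (poissonKer b y : ℂ) * h b :=
    ((integrable_poissonKer hb).ofReal).mul_const _
  rw [integral_const_mul, integral_sub (hh.integrable hb) hi, integral_mul_const] at h0
  have h1 : ∫ y, (poissonKer b y : ℂ) = 1 := by
    rw [integral_complex_ofReal, integral_poissonKer hb, ofReal_one]
  rw [h1, one_mul] at h0
  have : (-(π / b : ℝ) : ℂ) ≠ 0 := by
    have : π / b ≠ 0 := by positivity
    exact_mod_cast neg_ne_zero.2 this
  exact sub_eq_zero.1 ((mul_eq_zero.1 h0).resolve_left this)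

lemma one_add_norm_le_of_re_nonneg {v : ℂ} (hv : 0 ≤ v.re) {b : ℝ} (hb : 0 < b) :
    1 + ‖v‖ ≤ (1 + 1 / b) * ‖v + b‖ := by
  have h1 : b ≤ ‖v + b‖ := by
    have := re_le_norm (v + b)
    simp at this
    linarith
  have h2 : ‖v‖ ≤ ‖v + b‖ := by
    rw [Complex.norm_def, Complex.norm_def]
    apply Real.sqrt_le_sqrt
    simp [normSq_apply]
    nlinarith
  have h3 : 1 ≤ 1 / b * ‖v + b‖ := by
    rw [one_div, ← div_eq_inv_mul, le_div_iff₀ hb]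
    linarith
  linarith

lemma add_ofReal_ne_zero {v : ℂ} (hv : 0 ≤ v.re) {b : ℝ} (hb : 0 < b) : v + b ≠ 0 := by
  intro h0
  have := congrArg re h0
  simp at this
  linarith

/-- The difference of two Cauchy kernels. -/
noncomputable def cauchyDiff (b b₁ y : ℝ) : ℂ := 1 / (b + y * I) - 1 / (b₁ + y * I)

lemma cauchyDiff_eq {b b₁ : ℝ} (hb : 0 < b) (hb₁ : 0 < b₁) (y : ℝ) :
    cauchyDiff b b₁ y = (b₁ - b) / ((y * I + b) * (y * I + b₁)) := by
  have h1 := add_ofReal_ne_zero (v := y * I) (by simp) hb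
  have h2 := add_ofReal_ne_zero (v := y * I) (by simp) hb₁
  unfold cauchyDiff
  rw [add_comm (b : ℂ), add_comm (b₁ : ℂ)]
  field_simp
  ring

lemma continuous_cauchyDiff {b b₁ : ℝ} (hb : 0 < b) (hb₁ : 0 < b₁) :
    Continuous (cauchyDiff b b₁) := by
  unfold cauchyDiff
  refine Continuous.sub ?_ ?_
  · refine Continuous.div (by fun_prop) (by fun_prop) fun y => ?_
    rw [add_comm]
    exact add_ofReal_ne_zero (by simp) hb
  · refine Continuous.div (by fun_prop) (by fun_prop) fun y => ?_
    rw [add_comm]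
    exact add_ofReal_ne_zero (by simp) hb₁

lemma norm_sq_mul_I_add (y b : ℝ) : ‖(y * I + b : ℂ)‖ ^ 2 = b ^ 2 + y ^ 2 := by
  rw [← normSq_eq_norm_sq]
  simp [normSq_apply]
  ring

lemma norm_cauchyDiff_le {b b₁ : ℝ} (hb : 0 < b) (hbb : b ≤ b₁) (y : ℝ) :
    ‖cauchyDiff b b₁ y‖ ≤ (b₁ - b) * (b ^ 2 + y ^ 2)⁻¹ := by
  have hb₁ := hb.trans_le hbb
  rw [cauchyDiff_eq hb hb₁, norm_div, norm_mul, ← norm_sq_mul_I_add, ← div_eq_mul_inv, sq,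
    ← ofReal_sub, norm_real, Real.norm_of_nonneg (sub_nonneg.2 hbb)]
  have h1 := norm_pos_iff.2 (add_ofReal_ne_zero (v := y * I) (by simp) hb)
  gcongr
  refine (sq_le_sq₀ (norm_nonneg _) (norm_nonneg _)).1 ?_
  rw [norm_sq_mul_I_add, norm_sq_mul_I_add]
  gcongr

lemma TameOn.integral_cauchyDiff {h : ℂ → ℂ} (hh : TameOn h) {b b₁ : ℝ} (hb : 0 < b)
    (hbb : b ≤ b₁) : ∫ y : ℝ, cauchyDiff b b₁ y * h (y * I) = 0 := by
  have hb₁ := hb.trans_le hbb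
  obtain ⟨C, hC⟩ := hh.2
  have hC0 : 0 ≤ C := by
    have := (norm_nonneg _).trans (hC 0 le_rfl)
    simpa using this
  have := integral_vertical_eq_zero
    (f := fun v => (b₁ - b) / ((v + b) * (v + b₁)) * h v)
    (C := (b₁ - b) * (1 + 1 / b) * (1 + 1 / b₁) * C) (fun z hz => by
      have h1 := add_ofReal_ne_zero hz hb
      have h2 := add_ofReal_ne_zero hz hb₁
      have := hh.1 z hz
      have h3 := mul_ne_zero h1 h2
      fun_prop (disch := assumption)) (fun z hz => by
      have h1 := one_add_norm_le_of_re_nonneg hz hb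
      have h2 := one_add_norm_le_of_re_nonneg hz hb₁
      have p1 := norm_pos_iff.2 (add_ofReal_ne_zero hz hb)
      have p2 := norm_pos_iff.2 (add_ofReal_ne_zero hz hb₁)
      have p3 : 0 < 1 + ‖z‖ := by positivity
      rw [norm_mul, norm_div, norm_mul, ← ofReal_sub, norm_real,
        Real.norm_of_nonneg (sub_nonneg.2 hbb)]
      have e : (1 + ‖z‖) ^ (1 / 2 : ℝ) = (1 + ‖z‖) ^ (-(3 / 2) : ℝ) * (1 + ‖z‖) ^ 2 := by
        rw [← Real.rpow_natCast, ← Real.rpow_add (by positivity)]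
        norm_num
      have h4 := hC z hz
      rw [e] at h4
      have h5 : (1 + ‖z‖) ^ 2 ≤ (1 + 1 / b) * ‖z + b‖ * ((1 + 1 / b₁) * ‖z + b₁‖) := by
        rw [sq]
        exact mul_le_mul h1 h2 p3.le (by positivity)
      have hbb' := sub_nonneg.2 hbb
      rw [div_mul_eq_mul_div, div_le_iff₀ (by positivity)]
      calc (b₁ - b) * ‖h z‖ ≤ (b₁ - b) * (C * ((1 + ‖z‖) ^ (-(3 / 2) : ℝ) *
            ((1 + 1 / b) * ‖z + b‖ * ((1 + 1 / b₁) * ‖z + b₁‖)))) := by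
            refine mul_le_mul_of_nonneg_left (h4.trans ?_) hbb'
            gcongr
        _ = _ := by ring)
  rw [← this]
  simp_rw [cauchyDiff_eq hb hb₁]

lemma cauchyDiff_add_conj {b b₁ : ℝ} (hb : 0 < b) (hb₁ : 0 < b₁) (y : ℝ) :
    cauchyDiff b b₁ y + (starRingEnd ℂ) (cauchyDiff b b₁ y) =
      2 * π * (poissonKer b y - poissonKer b₁ y) := by
  have key : ∀ {c : ℝ}, 0 < c → (1 / (c + y * I : ℂ)).re = π * poissonKer c y := by
    intro c hc
    rw [one_div, inv_re]
    unfold poissonKer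
    simp [normSq_apply]
    field_simp
  rw [add_conj, cauchyDiff, sub_re, key hb, key hb₁]
  push_cast
  ring

theorem TameOn.sub_eq_integral {h : ℂ → ℂ} (hh : TameOn h) {b b₁ : ℝ} (hb : 0 < b)
    (hbb : b ≤ b₁) :
    ∫ y : ℝ, (starRingEnd ℂ) (cauchyDiff b b₁ y) * ((h (y * I)).re : ℂ) = π * (h b - h b₁) := by
  have hb₁ := hb.trans_le hbb
  have h0 := hh.integral_cauchyDiff hb hbb
  have h0' : ∫ y : ℝ, (starRingEnd ℂ) (cauchyDiff b b₁ y) * (starRingEnd ℂ) (h (y * I)) = 0 := by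
    rw [← map_zero (starRingEnd ℂ), ← h0, ← integral_conj]
    simp
  have i1 : Integrable fun y : ℝ => (starRingEnd ℂ) (cauchyDiff b b₁ y) * h (y * I) :=
    hh.integrable_mul hb (continuous_conj.comp (continuous_cauchyDiff hb hb₁)) (D := b₁ - b)
      (fun y => by simpa using norm_cauchyDiff_le hb hbb y)
  have i2 : Integrable fun y : ℝ => cauchyDiff b b₁ y * h (y * I) :=
    hh.integrable_mul hb (continuous_cauchyDiff hb hb₁) (norm_cauchyDiff_le hb hbb)
  have i3 : Integrable fun y : ℝ =>
      (starRingEnd ℂ) (cauchyDiff b b₁ y) * (starRingEnd ℂ) (h (y * I)) := by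
    have := (Complex.conjLIE.toContinuousLinearEquiv.toContinuousLinearMap).integrable_comp i2
    refine this.congr (Eventually.of_forall fun y => ?_)
    simp
  have h1 : ∫ y : ℝ, (starRingEnd ℂ) (cauchyDiff b b₁ y) * h (y * I) = 2 * π * (h b - h b₁) := by
    have e : ∀ y : ℝ, (starRingEnd ℂ) (cauchyDiff b b₁ y) * h (y * I) =
        2 * π * ((poissonKer b y : ℂ) * h (y * I) - (poissonKer b₁ y : ℂ) * h (y * I)) -
          cauchyDiff b b₁ y * h (y * I) := by
      intro y
      linear_combination h (y * I) * cauchyDiff_add_conj hb hb₁ y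
    have i4 : Integrable fun y : ℝ =>
        2 * π * ((poissonKer b y : ℂ) * h (y * I) - (poissonKer b₁ y : ℂ) * h (y * I)) :=
      ((hh.integrable hb).sub (hh.integrable hb₁)).const_mul _
    simp_rw [e]
    rw [integral_sub i4 i2, h0, sub_zero,
      integral_const_mul, integral_sub (hh.integrable hb) (hh.integrable hb₁), hh.poisson hb,
      hh.poisson hb₁]
  have e : ∀ y : ℝ, (starRingEnd ℂ) (cauchyDiff b b₁ y) * ((h (y * I)).re : ℂ) =
      (1 / 2) * ((starRingEnd ℂ) (cauchyDiff b b₁ y) * h (y * I) +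
        (starRingEnd ℂ) (cauchyDiff b b₁ y) * (starRingEnd ℂ) (h (y * I))) := by
    intro y
    rw [← mul_add, add_conj]
    push_cast
    ring
  simp_rw [e]
  rw [integral_const_mul, integral_add i1 i3, h1, h0']
  ring

lemma abs_im_cauchyDiff_le {b b₁ : ℝ} (hb : 0 < b) (hbb : b ≤ b₁) (y : ℝ) :
    |(cauchyDiff b b₁ y).im| ≤ π * b₁ * poissonKer b₁ y * (|y| / (b ^ 2 + y ^ 2)) := by
  have hb₁ := hb.trans_le hbb
  have key : ∀ c : ℝ, (1 / (c + y * I : ℂ)).im = -(y / (c ^ 2 + y ^ 2)) := by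
    intro c
    rw [one_div, inv_im]
    simp [normSq_apply]
    ring
  have e : (cauchyDiff b b₁ y).im = -(y * (b₁ ^ 2 - b ^ 2) / ((b ^ 2 + y ^ 2) * (b₁ ^ 2 + y ^ 2))) := by
    rw [cauchyDiff, sub_im, key, key]
    have h1 : b ^ 2 + y ^ 2 ≠ 0 := by positivity
    have h2 : b₁ ^ 2 + y ^ 2 ≠ 0 := by positivity
    field_simp
    ring
  have h2 : b ^ 2 ≤ b₁ ^ 2 := by gcongr
  rw [e, abs_neg, abs_div, abs_mul, abs_of_nonneg (sub_nonneg.2 h2),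
    abs_of_nonneg (show 0 ≤ (b ^ 2 + y ^ 2) * (b₁ ^ 2 + y ^ 2) by positivity)]
  have : π * b₁ * poissonKer b₁ y * (|y| / (b ^ 2 + y ^ 2)) =
      |y| * b₁ ^ 2 / ((b ^ 2 + y ^ 2) * (b₁ ^ 2 + y ^ 2)) := by
    unfold poissonKer
    field_simp
  rw [this]
  gcongr
  nlinarith

lemma lintegral_abs_div_le {b₁ : ℝ} (hb₁ : 0 < b₁) (y : ℝ) :
    ∫⁻ b in Ioc 0 b₁, ENNReal.ofReal (|y| / (b ^ 2 + y ^ 2)) ≤ ENNReal.ofReal (π / 2) := by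
  rcases eq_or_ne y 0 with rfl | hy
  · simp
  have hy' : 0 < |y| := abs_pos.2 hy
  have hc : Continuous fun b : ℝ => |y| / (b ^ 2 + y ^ 2) :=
    Continuous.div (by fun_prop) (by fun_prop) fun b => by positivity
  rw [← ofReal_integral_eq_lintegral_ofReal, ← intervalIntegral.integral_of_le hb₁.le]
  · apply ENNReal.ofReal_le_ofReal
    rw [intervalIntegral.integral_eq_sub_of_hasDerivAt (f := fun b => Real.arctan (b / |y|))
      (fun b _ => ?_) (hc.intervalIntegrable _ _)]
    · have := Real.arctan_lt_pi_div_two (b₁ / |y|)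
      simp
      linarith
    · have h := ((hasDerivAt_id b).div_const |y|).arctan
      have e : 1 / (1 + (id b / |y|) ^ 2) * (1 / |y|) = |y| / (b ^ 2 + y ^ 2) := by
        have : b ^ 2 + y ^ 2 ≠ 0 := by positivity
        rw [← sq_abs y] at this ⊢
        simp only [id]
        field_simp
        rw [add_comm]
      rw [← e]
      exact h
  · exact hc.integrableOn_Icc.mono_set Ioc_subset_Icc_self
  · exact Eventually.of_forall fun b => by positivity

/-- The imaginary part of a function of moderate growth with nonnegative real part, integrated
along the real axis near the boundary of the half-plane. -/
theorem TameOn.norm_integral_im_le {h : ℂ → ℂ} (hh : TameOn h)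
    (hpos : ∀ y : ℝ, 0 ≤ (h (y * I)).re) {b₁ : ℝ} (hb₁ : 0 < b₁) :
    |∫ b in Ioc 0 b₁, (h b - h b₁).im| ≤ π / 2 * b₁ * (h b₁).re := by
  have hi := hh.integrable hb₁
  have hre : ∫ y : ℝ, poissonKer b₁ y * (h (y * I)).re = (h b₁).re := by
    have := congrArg re (hh.poisson hb₁)
    rw [← this]
    have e := integral_re (𝕜 := ℂ) hi
    simp only [RCLike.re_to_complex] at e
    rw [← e]
    simp
  have hire : Integrable fun y : ℝ => poissonKer b₁ y * (h (y * I)).re := by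
    simpa using hi.re
  have hcre : Continuous fun y : ℝ => (h (y * I)).re := continuous_re.comp hh.continuous
  set F : ℝ → ℝ → ENNReal := fun b y =>
    ENNReal.ofReal (b₁ * (poissonKer b₁ y * (h (y * I)).re) * (|y| / (b ^ 2 + y ^ 2))) with hF
  have hnn : ∀ y, 0 ≤ b₁ * (poissonKer b₁ y * (h (y * I)).re) := fun y =>
    mul_nonneg hb₁.le (mul_nonneg (poissonKer_nonneg hb₁ y) (hpos y))
  have hpt : ∀ b ∈ Ioc 0 b₁, ENNReal.ofReal ‖(h b - h b₁).im‖ ≤ ∫⁻ y, F b y := by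
    intro b hb
    have h1 := congrArg im (hh.sub_eq_integral hb.1 hb.2)
    have i1 : Integrable fun y : ℝ =>
        (starRingEnd ℂ) (cauchyDiff b b₁ y) * ((h (y * I)).re : ℂ) := by
      obtain ⟨C, hC⟩ := hh.2
      refine integrable_of_growth hb.1 (continuous_ofReal.comp hcre)
        (continuous_conj.comp (continuous_cauchyDiff hb.1 hb₁)) (C := C) (D := b₁ - b)
        (fun y => ?_) (fun y => by simpa using norm_cauchyDiff_le hb.1 hb.2 y)
      have h2 := hC (y * I) (by simp)
      simp only [norm_real, Real.norm_eq_abs]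
      exact (abs_re_le_norm _).trans (by simpa using h2)
    have e := integral_im (𝕜 := ℂ) i1
    simp only [RCLike.im_to_complex] at e
    rw [← e] at h1
    have h3 : (h b - h b₁).im = ∫ y : ℝ,
        π⁻¹ * ((starRingEnd ℂ) (cauchyDiff b b₁ y) * ((h (y * I)).re : ℂ)).im := by
      rw [integral_const_mul, h1, im_ofReal_mul]
      field_simp
    rw [h3]
    calc ENNReal.ofReal ‖_‖ ≤ ∫⁻ y : ℝ, ENNReal.ofReal
          ‖π⁻¹ * ((starRingEnd ℂ) (cauchyDiff b b₁ y) * ((h (y * I)).re : ℂ)).im‖ := by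
          refine ENNReal.ofReal_le_of_le_toReal (norm_integral_le_lintegral_norm _)
      _ ≤ _ := by
          refine lintegral_mono fun y => ENNReal.ofReal_le_ofReal ?_
          rw [im_mul_ofReal, conj_im, norm_mul, norm_mul, norm_neg, Real.norm_of_nonneg (hpos y),
            Real.norm_of_nonneg (inv_nonneg.2 pi_pos.le), Real.norm_eq_abs]
          have h4 := abs_im_cauchyDiff_le hb.1 hb.2 y
          calc π⁻¹ * (|(cauchyDiff b b₁ y).im| * (h (y * I)).re) ≤
              π⁻¹ * (π * b₁ * poissonKer b₁ y * (|y| / (b ^ 2 + y ^ 2)) * (h (y * I)).re) := by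
                gcongr
                exact hpos y
            _ = _ := by field_simp
  have hmeas : Measurable (Function.uncurry F) := by
    have m1 : Measurable fun p : ℝ × ℝ => b₁ * (poissonKer b₁ p.2 * (h (p.2 * I)).re) :=
      (((continuous_poissonKer hb₁).mul hcre).const_mul b₁).measurable.comp measurable_snd
    have m2 : Measurable fun p : ℝ × ℝ => |p.2| / (p.1 ^ 2 + p.2 ^ 2) := by fun_prop
    exact (m1.mul m2).ennreal_ofReal
  have hbound : ∫⁻ b in Ioc 0 b₁, ENNReal.ofReal ‖(h b - h b₁).im‖ ≤
      ENNReal.ofReal (π / 2 * b₁ * (h b₁).re) := by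
    calc ∫⁻ b in Ioc 0 b₁, ENNReal.ofReal ‖(h b - h b₁).im‖
        ≤ ∫⁻ b in Ioc 0 b₁, ∫⁻ y, F b y := setLIntegral_mono' measurableSet_Ioc hpt
      _ = ∫⁻ y, ∫⁻ b in Ioc 0 b₁, F b y := lintegral_lintegral_swap hmeas.aemeasurable
      _ ≤ ∫⁻ y, ENNReal.ofReal (b₁ * (poissonKer b₁ y * (h (y * I)).re)) *
            ENNReal.ofReal (π / 2) := by
          refine lintegral_mono fun y => ?_
          simp only [hF, ENNReal.ofReal_mul (hnn y)]
          rw [lintegral_const_mul _ (by fun_prop)]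
          gcongr
          exact lintegral_abs_div_le hb₁ y
      _ = ENNReal.ofReal (π / 2 * b₁ * (h b₁).re) := by
          rw [lintegral_mul_const' _ _ ENNReal.ofReal_ne_top,
            ← ofReal_integral_eq_lintegral_ofReal (hire.const_mul b₁) (Eventually.of_forall hnn),
            integral_const_mul, hre, ← ENNReal.ofReal_mul]
          · congr 1; ring
          · rw [← hre]
            exact mul_nonneg hb₁.le (integral_nonneg fun y =>
              mul_nonneg (poissonKer_nonneg hb₁ y) (hpos y))
  have hfin : 0 ≤ π / 2 * b₁ * (h b₁).re := by
    rw [← hre]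
    exact mul_nonneg (by positivity) (integral_nonneg fun y =>
      mul_nonneg (poissonKer_nonneg hb₁ y) (hpos y))
  have := (norm_integral_le_lintegral_norm (μ := volume.restrict (Ioc 0 b₁))
    (fun b : ℝ => (h b - h b₁).im)).trans (ENNReal.toReal_mono ENNReal.ofReal_ne_top hbound)
  rwa [ENNReal.toReal_ofReal hfin, Real.norm_eq_abs] at this

lemma integral_poissonKer_mul_exp_of_nonneg {b : ℝ} (hb : 0 < b) {u : ℝ} (hu : 0 ≤ u) :
    ∫ y : ℝ, (poissonKer b y : ℂ) * cexp (-(u * (y * I))) = cexp (-(u * b)) := by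
  simpa using ((TameOn.const 1).mul_exp hu).poisson hb

lemma poissonKer_neg (b y : ℝ) : poissonKer b (-y) = poissonKer b y := by
  simp [poissonKer]

/-- The Fourier transform of the Poisson kernel. -/
lemma integral_poissonKer_mul_exp {b : ℝ} (hb : 0 < b) (θ : ℝ) :
    ∫ y : ℝ, (poissonKer b y : ℂ) * cexp (θ * (y * I)) = cexp (-(b * |θ| : ℝ)) := by
  rcases le_total 0 θ with h | h
  · rw [← integral_neg_eq_self, abs_of_nonneg h]
    convert integral_poissonKer_mul_exp_of_nonneg hb h using 2
    · ext y
      rw [poissonKer_neg]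
      push_cast
      ring_nf
    · push_cast
      ring_nf
  · rw [abs_of_nonpos h]
    convert integral_poissonKer_mul_exp_of_nonneg hb (neg_nonneg.2 h) using 2
    · ext y
      push_cast
      ring_nf
    · push_cast
      ring_nf

lemma strip_nhds {b : ℝ} (hb : 0 < b) (hb2 : b < 2) :
    {z : ℂ | 0 ≤ z.re ∧ z.re ≤ 2} ∈ 𝓝 (b : ℂ) := by
  have : IsOpen {z : ℂ | 0 < z.re ∧ z.re < 2} :=
    (isOpen_lt continuous_const continuous_re).inter (isOpen_lt continuous_re continuous_const)
  exact mem_of_superset (this.mem_nhds ⟨by simpa, by simpa⟩) fun z hz => ⟨hz.1.le, hz.2.le⟩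

lemma isClosed_strip : IsClosed {z : ℂ | 0 ≤ z.re ∧ z.re ≤ 2} :=
  (isClosed_le continuous_const continuous_re).inter (isClosed_le continuous_re continuous_const)

/-- The kernel `1/(v² - b²)` on the line `Re v = 2`. -/
noncomputable def lineKer (b y : ℝ) : ℂ := 1 / ((2 + y * I - b) * (2 + y * I + b))

lemma lineKer_ne {b : ℝ} (hb : 0 < b) (hb2 : b < 2) (y : ℝ) :
    (2 + y * I - b : ℂ) ≠ 0 ∧ (2 + y * I + b : ℂ) ≠ 0 := by
  constructor
  · intro h
    have := congrArg re h
    simp at this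
    linarith
  · intro h
    have := congrArg re h
    simp at this
    linarith

lemma continuous_lineKer {b : ℝ} (hb : 0 < b) (hb2 : b < 2) : Continuous (lineKer b) := by
  unfold lineKer
  refine Continuous.div (by fun_prop) (by fun_prop) fun y => ?_
  exact mul_ne_zero (lineKer_ne hb hb2 y).1 (lineKer_ne hb hb2 y).2

lemma norm_lineKer_le {b : ℝ} (hb : 0 < b) (hb2 : b < 2) (y : ℝ) :
    ‖lineKer b y‖ ≤ 1 * ((2 - b) ^ 2 + y ^ 2)⁻¹ := by
  have h1 : ‖(2 + y * I - b : ℂ)‖ ^ 2 = (2 - b) ^ 2 + y ^ 2 := by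
    rw [← normSq_eq_norm_sq]
    simp [normSq_apply]
    ring
  have h2 : ‖(2 + y * I + b : ℂ)‖ ^ 2 = (2 + b) ^ 2 + y ^ 2 := by
    rw [← normSq_eq_norm_sq]
    simp [normSq_apply]
    ring
  unfold lineKer
  rw [norm_div, norm_mul, ← h1, norm_one, ← div_eq_mul_inv, sq]
  have := norm_pos_iff.2 (lineKer_ne hb hb2 y).1
  gcongr
  refine (sq_le_sq₀ (norm_nonneg _) (norm_nonneg _)).1 ?_
  rw [h1, h2]
  nlinarith

lemma integrable_lineKer_mul {b : ℝ} (hb : 0 < b) (hb2 : b < 2) {φ : ℝ → ℂ} (hφ : Continuous φ)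
    {C : ℝ} (hC : ∀ y, ‖φ y‖ ≤ C * (1 + |y|) ^ (1 / 2 : ℝ)) :
    Integrable fun y => lineKer b y * φ y :=
  integrable_of_growth (sub_pos.2 hb2) hφ (continuous_lineKer hb hb2) hC (norm_lineKer_le hb hb2)

lemma integral_lineKer {b : ℝ} (hb : 0 < b) (hb2 : b < 2) : ∫ y, lineKer b y = 0 := by
  have hb2' := sub_pos.2 hb2
  have hb3 : 0 < 2 + b := by linarith
  have := integral_vertical_eq_zero
    (f := fun v => 1 / ((v + (2 - b : ℝ)) * (v + (2 + b : ℝ))))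
    (C := (1 + 1 / (2 - b)) * (1 + 1 / (2 + b))) (fun z hz => by
      have h3 := mul_ne_zero (add_ofReal_ne_zero hz hb2') (add_ofReal_ne_zero hz hb3)
      fun_prop (disch := assumption)) (fun z hz => by
      have h1 := one_add_norm_le_of_re_nonneg hz hb2'
      have h2 := one_add_norm_le_of_re_nonneg hz hb3
      have p1 := norm_pos_iff.2 (add_ofReal_ne_zero hz hb2')
      have p2 := norm_pos_iff.2 (add_ofReal_ne_zero hz hb3)
      have p3 : 0 < 1 + ‖z‖ := by positivity
      rw [norm_div, norm_mul, norm_one, div_le_iff₀ (by positivity)]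
      have e : 1 ≤ (1 + ‖z‖) ^ (-(3 / 2) : ℝ) * (1 + ‖z‖) ^ 2 := by
        rw [← Real.rpow_natCast, ← Real.rpow_add (by positivity)]
        exact Real.one_le_rpow (by linarith [norm_nonneg z]) (by norm_num)
      have h5 : (1 + ‖z‖) ^ 2 ≤ (1 + 1 / (2 - b)) * ‖z + (2 - b : ℝ)‖ *
          ((1 + 1 / (2 + b)) * ‖z + (2 + b : ℝ)‖) := by
        rw [sq]
        exact mul_le_mul h1 h2 p3.le (by positivity)
      calc 1 ≤ (1 + ‖z‖) ^ (-(3 / 2) : ℝ) * (1 + ‖z‖) ^ 2 := e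
        _ ≤ (1 + ‖z‖) ^ (-(3 / 2) : ℝ) * ((1 + 1 / (2 - b)) * ‖z + (2 - b : ℝ)‖ *
          ((1 + 1 / (2 + b)) * ‖z + (2 + b : ℝ)‖)) := by gcongr
        _ = _ := by ring)
  rw [← this]
  congr 1
  ext y
  unfold lineKer
  push_cast
  ring_nf

/-- Shifting a kernel integral from the imaginary axis to the line `Re v = 2`. -/
lemma integral_lineKer_shift {h : ℂ → ℂ} {b : ℝ} (hb : 0 < b) (hb2 : b < 2) {C : ℝ}
    (hd : ∀ z : ℂ, 0 ≤ z.re → z.re ≤ 2 → DifferentiableAt ℂ h z)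
    (hC : ∀ z : ℂ, 0 ≤ z.re → z.re ≤ 2 → ‖h z‖ ≤ C * (1 + ‖z‖) ^ (1 / 2 : ℝ)) :
    ∫ y : ℝ, lineKer b y * h (2 + y * I) =
      (π / b : ℝ) * (h b - ∫ y : ℝ, (poissonKer b y : ℂ) * h (y * I)) := by
  have hcont : ∀ x : ℝ, 0 ≤ x → x ≤ 2 → Continuous fun y : ℝ => h (x + y * I) := by
    intro x hx hx'
    refine continuous_iff_continuousAt.2 fun y => ?_
    have h0 := (hd (x + y * I) (by simpa) (by simpa)).continuousAt
    exact ContinuousAt.comp (g := h) (f := fun y : ℝ => (x + y * I : ℂ)) h0 (by fun_prop)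
  have hC0 : 0 ≤ C := by
    have := (norm_nonneg _).trans (hC 0 (by simp) (by simp))
    simpa using this
  obtain ⟨C', hC'⟩ := dslope_div_decay isClosed_strip hb (strip_nhds hb hb2)
    (fun z hz => hz.1) (fun z hz => hd z hz.1 hz.2) (fun z hz => hC z hz.1 hz.2)
  have h0 := integral_vertical_eq_of_strip zero_le_two
    (fun z h1 h2 => (hC' z ⟨h1, h2⟩).1) (fun z h1 h2 => (hC' z ⟨h1, h2⟩).2)
  simp_rw [poissonKer_mul_sub hb] at h0
  have hi : Integrable fun y => (poissonKer b y : ℂ) * h b :=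
    ((integrable_poissonKer hb).ofReal).mul_const _
  have hi' : Integrable fun y : ℝ => (poissonKer b y : ℂ) * h (y * I) := by
    refine integrable_of_growth hb ?_ (continuous_ofReal.comp (continuous_poissonKer hb)) (C := C)
      (fun y => ?_) (norm_poissonKer hb)
    · simpa using hcont 0 le_rfl zero_le_two
    · simpa using hC (y * I) (by simp) (by simp)
  have hl : ∀ y : ℝ, dslope h b ((2 : ℝ) + y * I) / ((2 : ℝ) + y * I + b) =
      lineKer b y * h (2 + y * I) - lineKer b y * h b := by
    intro y
    have h1 := (lineKer_ne hb hb2 y).1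
    have h2 := (lineKer_ne hb hb2 y).2
    have h3 : ((2 : ℝ) + y * I : ℂ) ≠ b := by
      push_cast
      exact sub_ne_zero.1 h1
    rw [dslope_of_ne _ h3, slope_def_field, lineKer]
    push_cast
    field_simp
  have hi2 : Integrable fun y : ℝ => lineKer b y * h b :=
    integrable_lineKer_mul hb hb2 continuous_const (C := ‖h b‖) fun y =>
      le_mul_of_one_le_right (norm_nonneg _)
        (Real.one_le_rpow (by linarith [abs_nonneg y]) (by norm_num))
  have hi3 : Integrable fun y : ℝ => lineKer b y * h (2 + y * I) := by
    refine integrable_lineKer_mul hb hb2 (by simpa using hcont 2 zero_le_two le_rfl)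
      (C := C * 3 ^ (1 / 2 : ℝ)) (fun y => ?_)
    refine (hC (2 + y * I) (by simp) (by simp)).trans ?_
    rw [mul_assoc, ← Real.mul_rpow (by norm_num) (by positivity)]
    have : ‖(2 + y * I : ℂ)‖ ≤ 2 + |y| := (norm_add_le _ _).trans (by simp)
    gcongr
    linarith [abs_nonneg y]
  simp_rw [hl] at h0
  have h1 : ∫ y, (poissonKer b y : ℂ) = 1 := by
    rw [integral_complex_ofReal, integral_poissonKer hb, ofReal_one]
  rw [integral_sub hi3 hi2, integral_mul_const, integral_lineKer hb hb2, integral_const_mul,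
    integral_sub hi' hi, integral_mul_const, h1] at h0
  linear_combination h0

lemma integral_lineKer_mul_exp {b : ℝ} (hb : 0 < b) (hb2 : b < 2) (θ : ℝ) :
    ∫ y : ℝ, lineKer b y * cexp (θ * (2 + y * I)) =
      (π / b : ℝ) * ((Real.exp (θ * b) - Real.exp (-(b * |θ|)) : ℝ) : ℂ) := by
  have := integral_lineKer_shift (h := fun z => cexp (θ * z)) hb hb2
    (C := Real.exp (|θ| * 2)) (fun z _ _ => by fun_prop) (fun z h1 h2 => by
      rw [norm_exp]
      refine le_trans ?_ (le_mul_of_one_le_right (Real.exp_pos _).le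
        (Real.one_le_rpow (by linarith [norm_nonneg z]) (by norm_num)))
      simp only [mul_re, ofReal_re, ofReal_im, zero_mul, sub_zero]
      refine Real.exp_le_exp.2 ?_
      calc θ * z.re ≤ |θ| * z.re := by gcongr; exact le_abs_self θ
        _ ≤ _ := by gcongr)
  rw [this, integral_poissonKer_mul_exp hb]
  push_cast
  rfl

/-- A weighted explicit formula: the Fourier coefficients of a Dirichlet series against the
Poisson kernel are given by its value at `b` and a finite Dirichlet polynomial. -/
theorem TameOn.norm_fourier_sub_le {g : ℂ → ℂ} (hg : TameOn g) {a : ℕ → ℂ}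
    (hsum : Summable fun n : ℕ => ‖a n‖ * Real.exp (-2 * Real.log n))
    (ha : ∀ v : ℂ, v.re = 2 → HasSum (fun n : ℕ => a n * cexp (-(Real.log n * v))) (g v))
    {u b : ℝ} (hu : 0 ≤ u) (hb : 0 < b) (hb2 : b < 2) :
    ‖(∫ y : ℝ, (poissonKer b y : ℂ) * (g (y * I) * cexp (u * (y * I)))) - Real.exp (u * b) * g b‖ ≤
      Real.exp (u * b) * ∑ n ∈ Finset.range ⌈Real.exp u⌉₊, ‖a n‖ := by
  obtain ⟨C, hC⟩ := hg.2
  have hshift := integral_lineKer_shift (h := fun z => g z * cexp (u * z)) hb hb2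
    (C := C * Real.exp (u * 2)) (fun z h1 _ => (hg.1 z h1).mul (by fun_prop)) (fun z h1 h2 => by
      rw [norm_mul, norm_exp, mul_right_comm]
      have : (u * z : ℂ).re ≤ u * 2 := by
        simp only [mul_re, ofReal_re, ofReal_im, zero_mul, sub_zero]
        gcongr
      gcongr
      · exact (norm_nonneg _).trans (hC z h1)
      · exact hC z h1)
  set F : ℕ → ℝ → ℂ := fun n y => a n * (lineKer b y * cexp ((u - Real.log n : ℝ) * (2 + y * I)))
    with hF
  have hFn : ∀ n y, ‖F n y‖ = ‖a n‖ * Real.exp (-2 * Real.log n) * Real.exp (u * 2) *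
      ‖lineKer b y‖ := by
    intro n y
    simp only [hF, norm_mul, norm_exp]
    have : (((u - Real.log n : ℝ) : ℂ) * (2 + y * I)).re = -2 * Real.log n + u * 2 := by
      rw [re_ofReal_mul]
      simp
      ring
    rw [this, Real.exp_add]
    ring
  have hFi : ∀ n, Integrable (F n) := by
    intro n
    refine Integrable.const_mul (integrable_lineKer_mul hb hb2 (by fun_prop)
      (C := Real.exp (u * 2 - 2 * Real.log n)) fun y => ?_) _
    rw [norm_exp]
    refine le_trans (le_of_eq ?_) (le_mul_of_one_le_right (Real.exp_pos _).le
        (Real.one_le_rpow (by linarith [abs_nonneg y]) (by norm_num)))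
    rw [re_ofReal_mul]
    simp
    ring
  have hFs : Summable fun n => ∫ y, ‖F n y‖ := by
    simp_rw [hFn, integral_const_mul]
    exact (hsum.mul_right _).mul_right _
  have hS := hasSum_integral_of_summable_integral_norm hFi hFs
  have hpt : ∀ y : ℝ, ∑' n, F n y = lineKer b y * (g (2 + y * I) * cexp (u * (2 + y * I))) := by
    intro y
    have h1 := (ha (2 + y * I) (by simp)).mul_right (lineKer b y * cexp (u * (2 + y * I)))
    have h2 : (fun n => F n y) = fun n : ℕ => a n * cexp (-(Real.log n * (2 + y * I))) *
        (lineKer b y * cexp (u * (2 + y * I))) := by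
      ext n
      simp only [hF]
      push_cast
      rw [sub_mul, sub_eq_add_neg, Complex.exp_add]
      ring
    rw [h2, h1.tsum_eq]
    ring
  simp_rw [hpt] at hS
  rw [hshift] at hS
  have hterm : ∀ n, ∫ y, F n y = (π / b : ℝ) * (a n *
      ((Real.exp ((u - Real.log n) * b) - Real.exp (-(b * |u - Real.log n|)) : ℝ) : ℂ)) := by
    intro n
    simp only [hF]
    rw [integral_const_mul, integral_lineKer_mul_exp hb hb2]
    ring
  simp_rw [hterm] at hS
  have hpb : ((π / b : ℝ) : ℂ) ≠ 0 := by
    have : π / b ≠ 0 := by positivity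
    exact_mod_cast this
  have hS2 := (hasSum_mul_left_iff hpb).1 hS
  have hz : ∀ n ∉ Finset.range ⌈Real.exp u⌉₊, a n *
      ((Real.exp ((u - Real.log n) * b) - Real.exp (-(b * |u - Real.log n|)) : ℝ) : ℂ) = 0 := by
    intro n hn
    have h1 : Real.exp u ≤ n := by simpa using hn
    have h2 : u - Real.log n ≤ 0 := by
      rw [sub_nonpos, Real.le_log_iff_exp_le ((Real.exp_pos u).trans_le h1)]
      exact h1
    rw [abs_of_nonpos h2]
    ring_nf
    simp
  have hfin := hasSum_sum_of_ne_finset_zero (L := .unconditional ℕ) hz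
  have heq := hS2.unique hfin
  rw [← neg_sub, norm_neg, show (Real.exp (u * b) : ℂ) * g b = g b * cexp (u * b) by
    push_cast; ring, heq]
  refine (norm_sum_le _ _).trans ?_
  rw [Finset.mul_sum]
  refine Finset.sum_le_sum fun n _ => ?_
  rw [norm_mul, mul_comm, norm_real, Real.norm_eq_abs]
  gcongr
  have h3 : Real.exp (-(b * |u - Real.log n|)) ≤ Real.exp ((u - Real.log n) * b) := by
    refine Real.exp_le_exp.2 ?_
    nlinarith [neg_abs_le (u - Real.log n)]
  have h4 : Real.exp ((u - Real.log n) * b) ≤ Real.exp (u * b) := by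
    refine Real.exp_le_exp.2 ?_
    nlinarith [Real.log_natCast_nonneg n]
  rw [abs_of_nonneg (sub_nonneg.2 h3)]
  linarith [Real.exp_pos (-(b * |u - Real.log n|))]

lemma add_two_re_pos {z : ℂ} (hz : 0 ≤ z.re) : 0 < (z + 2).re := by
  simp
  linarith

lemma two_le_norm_add_two {z : ℂ} (hz : 0 ≤ z.re) : 2 ≤ ‖z + 2‖ := by
  have := re_le_norm (z + 2)
  simp at this
  linarith

lemma abs_im_log_add_two_le {z : ℂ} (hz : 0 ≤ z.re) : |(Complex.log (z + 2)).im| ≤ π / 2 := by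
  rw [log_im]
  exact (abs_arg_lt_pi_div_two_iff.2 (Or.inl (add_two_re_pos hz))).le

lemma re_log_add_two_nonneg {z : ℂ} (hz : 0 ≤ z.re) : 0 ≤ (Complex.log (z + 2)).re := by
  rw [log_re]
  exact Real.log_nonneg (by linarith [two_le_norm_add_two hz])

lemma tameOn_log : TameOn fun z => 1 / 2 * Complex.log (z + 2) := by
  refine ⟨fun z hz => ?_, 2 + π, fun z hz => ?_⟩
  · have : z + 2 ∈ slitPlane := Or.inl (add_two_re_pos hz)
    fun_prop (disch := assumption)
  · have h1 : ‖Complex.log (z + 2)‖ ≤ (Complex.log (z + 2)).re + π / 2 := by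
      refine (norm_le_abs_re_add_abs_im _).trans ?_
      rw [abs_of_nonneg (re_log_add_two_nonneg hz)]
      gcongr
      exact abs_im_log_add_two_le hz
    have h2 : (Complex.log (z + 2)).re ≤ 4 * (1 + ‖z‖) ^ (1 / 2 : ℝ) := by
      rw [log_re]
      refine (Real.log_le_rpow_div (norm_nonneg _) (show (0 : ℝ) < 1 / 2 by norm_num)).trans ?_
      have h3 : ‖z + 2‖ ≤ 4 * (1 + ‖z‖) := by
        have := norm_add_le z 2
        simp only [Complex.norm_ofNat] at this
        linarith [norm_nonneg z]
      have h4 : (4 : ℝ) ^ (1 / 2 : ℝ) = 2 := by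
        rw [show (4 : ℝ) = 2 ^ (2 : ℝ) by norm_num, ← Real.rpow_mul (by norm_num)]
        norm_num
      calc ‖z + 2‖ ^ (1 / 2 : ℝ) / (1 / 2) ≤ (4 * (1 + ‖z‖)) ^ (1 / 2 : ℝ) / (1 / 2) := by gcongr
        _ = _ := by
          rw [Real.mul_rpow (by norm_num) (by positivity), h4]
          ring
    have h5 : 1 ≤ (1 + ‖z‖) ^ (1 / 2 : ℝ) :=
      Real.one_le_rpow (by linarith [norm_nonneg z]) (by norm_num)
    rw [norm_mul]
    norm_num at h1 ⊢
    nlinarith [pi_pos]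

/-- The function `g` shifted to have nonnegative real part on the imaginary axis. -/
noncomputable def shifted (g : ℂ → ℂ) (M : ℝ) (z : ℂ) : ℂ :=
  g z + (M + 1 / 2 * Complex.log (z + 2))

lemma tameOn_shifted {g : ℂ → ℂ} (hg : TameOn g) (M : ℝ) : TameOn (shifted g M) :=
  hg.add ((TameOn.const (M : ℂ)).add tameOn_log)

lemma shifted_re_nonneg {g : ℂ → ℂ} {M : ℝ}
    (hre : ∀ y : ℝ, -(M + 1 / 2 * Real.log ‖(y * I + 2 : ℂ)‖) ≤ (g (y * I)).re) (y : ℝ) :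
    0 ≤ (shifted g M (y * I)).re := by
  have := hre y
  have e : (1 / 2 * Complex.log (y * I + 2)).re = 1 / 2 * Real.log ‖(y * I + 2 : ℂ)‖ := by
    rw [show (1 / 2 : ℂ) = ((1 / 2 : ℝ) : ℂ) by push_cast; rfl, re_ofReal_mul, log_re]
  rw [shifted, add_re, add_re, e, ofReal_re]
  linarith

lemma log_add_two_ofReal {b : ℝ} (hb : 0 ≤ b) :
    (1 / 2 * Complex.log (b + 2) : ℂ) = (1 / 2 * Real.log (b + 2) : ℝ) := by
  rw [show (b + 2 : ℂ) = ((b + 2 : ℝ) : ℂ) by push_cast; rfl, ← ofReal_log (by linarith)]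
  push_cast
  rfl

lemma half_log_bounds {b : ℝ} (hb : 0 ≤ b) (hb1 : b ≤ 1) :
    0 ≤ 1 / 2 * Real.log (b + 2) ∧ 1 / 2 * Real.log (b + 2) ≤ 1 := by
  have h1 := Real.log_nonneg (show 1 ≤ b + 2 by linarith)
  have h2 := Real.log_le_sub_one_of_pos (show 0 < b + 2 by linarith)
  constructor <;> linarith

lemma norm_integral_log_le {b : ℝ} (hb : 0 < b) (hb1 : b ≤ 1) (u : ℝ) :
    ‖∫ y : ℝ, (poissonKer b y : ℂ) * (1 / 2 * Complex.log (y * I + 2) * cexp (u * (y * I)))‖ ≤ 2 := by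
  have hi := tameOn_log.integrable hb
  have hire : Integrable fun y : ℝ => poissonKer b y * (1 / 2 * Complex.log (y * I + 2)).re := by
    simpa using hi.re
  have hint_f : ∫ y : ℝ, poissonKer b y * (1 / 2 * Complex.log (y * I + 2)).re =
      1 / 2 * Real.log (b + 2) := by
    have := congrArg re (tameOn_log.poisson hb)
    rw [log_add_two_ofReal hb.le, ofReal_re] at this
    rw [← this]
    have e := integral_re (𝕜 := ℂ) hi
    simp only [RCLike.re_to_complex] at e
    rw [← e]
    simp
  calc _ ≤ ∫ y : ℝ, (poissonKer b y * (1 / 2 * Complex.log (y * I + 2)).re +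
        π / 4 * poissonKer b y) := by
        refine norm_integral_le_of_norm_le (hire.add ((integrable_poissonKer hb).const_mul _))
          (Eventually.of_forall fun y => ?_)
        have h0 : (0 : ℝ) ≤ (y * I : ℂ).re := by simp
        have h1 : ‖(1 / 2 * Complex.log (y * I + 2) : ℂ)‖ ≤
            (1 / 2 * Complex.log (y * I + 2)).re + π / 4 := by
          refine (norm_le_abs_re_add_abs_im _).trans ?_
          rw [show (1 / 2 : ℂ) = ((1 / 2 : ℝ) : ℂ) by push_cast; rfl, re_ofReal_mul, im_ofReal_mul,
            abs_of_nonneg (mul_nonneg (by norm_num) (re_log_add_two_nonneg h0)), abs_mul]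
          have := abs_im_log_add_two_le h0
          norm_num
          linarith
        have h2 : ‖cexp (u * (y * I))‖ = 1 := by
          rw [← mul_assoc, ← ofReal_mul, norm_exp_ofReal_mul_I]
        rw [norm_mul, norm_mul, h2, mul_one, norm_real, Real.norm_of_nonneg (poissonKer_nonneg hb y)]
        have := mul_le_mul_of_nonneg_left h1 (poissonKer_nonneg hb y)
        linarith
    _ = 1 / 2 * Real.log (b + 2) + π / 4 := by
        rw [integral_add hire ((integrable_poissonKer hb).const_mul _), hint_f, integral_const_mul,
          integral_poissonKer hb, mul_one]
    _ ≤ 2 := by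
        have := (half_log_bounds hb.le hb1).2
        linarith [pi_le_four]

/-- Positivity bounds the Fourier transform of a boundary value in both directions. -/
lemma TameOn.norm_fourier_le {h : ℂ → ℂ} (hh : TameOn h) (hpos : ∀ y : ℝ, 0 ≤ (h (y * I)).re)
    {b u : ℝ} (hb : 0 < b) (hu : 0 ≤ u) :
    ‖∫ y : ℝ, (poissonKer b y : ℂ) * (h (y * I) * cexp (u * (y * I)))‖ ≤
      2 * (h b).re + Real.exp (-(u * b)) * ‖h b‖ := by
  have hi := hh.integrable hb
  have hire : Integrable fun y : ℝ => poissonKer b y * (h (y * I)).re := by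
    simpa using hi.re
  have hint_f : ∫ y : ℝ, poissonKer b y * (h (y * I)).re = (h b).re := by
    rw [← hh.poisson hb]
    have e := integral_re (𝕜 := ℂ) hi
    simp only [RCLike.re_to_complex] at e
    rw [← e]
    simp
  have hexp : ∀ y : ℝ, ‖cexp (u * (y * I))‖ = 1 := fun y => by
    rw [← mul_assoc, ← ofReal_mul, norm_exp_ofReal_mul_I]
  have hconj : ∀ y : ℝ, (starRingEnd ℂ) (cexp (-(u * (y * I)))) = cexp (u * (y * I)) := by
    intro y
    rw [← exp_conj]
    simp
  have hQ := (hh.mul_exp hu).poisson hb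
  have hQi := (hh.mul_exp hu).integrable hb
  have hQ' : ∫ y : ℝ, (poissonKer b y : ℂ) * ((starRingEnd ℂ) (h (y * I)) * cexp (u * (y * I))) =
      (starRingEnd ℂ) (h b * cexp (-(u * b))) := by
    rw [← hQ, ← integral_conj]
    simp [hconj]
  have hQi' : Integrable fun y : ℝ =>
      (poissonKer b y : ℂ) * ((starRingEnd ℂ) (h (y * I)) * cexp (u * (y * I))) := by
    have := (Complex.conjLIE.toContinuousLinearEquiv.toContinuousLinearMap).integrable_comp hQi
    refine this.congr (Eventually.of_forall fun y => ?_)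
    simp [hconj]
  have hPi : Integrable fun y : ℝ => (poissonKer b y : ℂ) * (h (y * I) * cexp (u * (y * I))) := by
    refine hi.norm.mono' ?_ (Eventually.of_forall fun y => ?_)
    · exact ((continuous_ofReal.comp (continuous_poissonKer hb)).mul
        (hh.continuous.mul (by fun_prop))).aestronglyMeasurable
    · simp only [norm_mul, hexp, mul_one]
      rfl
  have hsum : (∫ y : ℝ, (poissonKer b y : ℂ) * (h (y * I) * cexp (u * (y * I)))) +
      (starRingEnd ℂ) (h b * cexp (-(u * b))) =
      ∫ y : ℝ, 2 * ((poissonKer b y * (h (y * I)).re : ℝ) : ℂ) * cexp (u * (y * I)) := by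
    rw [← hQ', ← integral_add hPi hQi']
    congr 1
    ext y
    rw [← mul_add, ← add_mul, add_conj]
    push_cast
    ring
  have hn : ‖∫ y : ℝ, 2 * ((poissonKer b y * (h (y * I)).re : ℝ) : ℂ) * cexp (u * (y * I))‖ ≤
      2 * (h b).re := by
    rw [← hint_f, ← integral_const_mul]
    refine norm_integral_le_of_norm_le (hire.const_mul 2) (Eventually.of_forall fun y => ?_)
    rw [norm_mul, hexp, mul_one, norm_mul, norm_real,
      Real.norm_of_nonneg (mul_nonneg (poissonKer_nonneg hb y) (hpos y))]
    simp
  have hc : ‖(starRingEnd ℂ) (h b * cexp (-(u * b)))‖ = Real.exp (-(u * b)) * ‖h b‖ := by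
    rw [RCLike.norm_conj, norm_mul, norm_exp, mul_comm]
    simp
  rw [← hsum] at hn
  have := norm_le_add_norm_add (∫ y : ℝ, (poissonKer b y : ℂ) * (h (y * I) * cexp (u * (y * I))))
    ((starRingEnd ℂ) (h b * cexp (-(u * b))))
  rw [hc] at this
  linarith

lemma exp_neg_three_le : Real.exp (-3) ≤ 1 / 20 := by
  rw [Real.exp_neg, one_div]
  apply inv_anti₀ (by norm_num)
  have := Real.exp_one_gt_d9
  have h : Real.exp 3 = Real.exp 1 ^ 3 := by
    rw [← Real.exp_nat_mul]
    norm_num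
  rw [h]
  calc (20 : ℝ) ≤ 2.7182818283 ^ 3 := by norm_num
    _ ≤ _ := by gcongr

/-- The value at a point not too close to the boundary is small. -/
lemma norm_le_of_three_le {g : ℂ → ℂ} (hg : TameOn g) {M : ℝ} (hM : 0 ≤ M)
    (hre : ∀ y : ℝ, -(M + 1 / 2 * Real.log ‖(y * I + 2 : ℂ)‖) ≤ (g (y * I)).re) {a : ℕ → ℂ}
    (hsum : Summable fun n : ℕ => ‖a n‖ * Real.exp (-2 * Real.log n))
    (ha : ∀ v : ℂ, v.re = 2 → HasSum (fun n : ℕ => a n * cexp (-(Real.log n * v))) (g v))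
    {u b : ℝ} (hu : 0 ≤ u) (hb : 0 < b) (hb1 : b ≤ 1) (hub : 3 ≤ u * b) :
    ‖g b‖ ≤ 3 * (M + 1) * Real.exp (-(u * b)) + 3 * Real.exp (-(u * b)) +
      2 * ∑ n ∈ Finset.range ⌈Real.exp u⌉₊, ‖a n‖ := by
  have h1 := hg.norm_fourier_sub_le hsum ha hu hb (by linarith)
  set W := ∑ n ∈ Finset.range ⌈Real.exp u⌉₊, ‖a n‖ with hW
  have hW0 : 0 ≤ W := Finset.sum_nonneg fun n _ => norm_nonneg _
  have hh := tameOn_shifted hg M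
  have h2 := hh.norm_fourier_le (shifted_re_nonneg hre) hb hu
  have h3 := norm_integral_log_le hb hb1 u
  have hexp : ∀ y : ℝ, ‖cexp (u * (y * I))‖ = 1 := fun y => by
    rw [← mul_assoc, ← ofReal_mul, norm_exp_ofReal_mul_I]
  have hint_f : ∀ {f : ℂ → ℂ}, TameOn f →
      Integrable fun y : ℝ => (poissonKer b y : ℂ) * (f (y * I) * cexp (u * (y * I))) := by
    intro f hf
    refine (hf.integrable hb).norm.mono' ?_ (Eventually.of_forall fun y => ?_)
    · exact ((continuous_ofReal.comp (continuous_poissonKer hb)).mul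
        (hf.continuous.mul (by fun_prop))).aestronglyMeasurable
    · simp only [norm_mul, hexp, mul_one]
      rfl
  have hM' : ∫ y : ℝ, (poissonKer b y : ℂ) * (M * cexp (u * (y * I))) =
      M * (Real.exp (-(u * b)) : ℝ) := by
    have := integral_poissonKer_mul_exp hb u
    rw [abs_of_nonneg hu] at this
    rw [mul_comm u b, ofReal_exp, ofReal_neg, ← this, ← integral_const_mul]
    congr 1
    ext y
    ring
  have hsplit : ∫ y : ℝ, (poissonKer b y : ℂ) * (g (y * I) * cexp (u * (y * I))) =
      (∫ y : ℝ, (poissonKer b y : ℂ) * (shifted g M (y * I) * cexp (u * (y * I)))) -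
      ((∫ y : ℝ, (poissonKer b y : ℂ) * (M * cexp (u * (y * I)))) +
      ∫ y : ℝ, (poissonKer b y : ℂ) * (1 / 2 * Complex.log (y * I + 2) * cexp (u * (y * I)))) := by
    have i1 := hint_f (TameOn.const M)
    have i2 := hint_f tameOn_log
    have i3 : Integrable fun y : ℝ => (poissonKer b y : ℂ) * (M * cexp (u * (y * I))) +
        (poissonKer b y : ℂ) * (1 / 2 * Complex.log (y * I + 2) * cexp (u * (y * I))) := i1.add i2
    rw [← integral_add i1 i2, ← integral_sub (hint_f hh) i3]
    congr 1
    ext y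
    simp only [shifted]
    ring
  set ε := Real.exp (-(u * b)) with hε
  have hε0 : 0 < ε := Real.exp_pos _
  have hε1 : ε ≤ 1 / 20 := (Real.exp_le_exp.2 (by linarith)).trans exp_neg_three_le
  obtain ⟨l0, l1⟩ := half_log_bounds hb.le hb1
  have hval : shifted g M b = g b + (M + 1 / 2 * Real.log (b + 2) : ℝ) := by
    rw [shifted, log_add_two_ofReal hb.le]
    push_cast
    ring
  have hnorm : ‖shifted g M b‖ ≤ ‖g b‖ + (M + 1) := by
    rw [hval]
    refine (norm_add_le _ _).trans ?_
    rw [norm_real, Real.norm_of_nonneg (by linarith)]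
    linarith
  have hrel : (shifted g M b).re ≤ ‖g b‖ + (M + 1) := (re_le_norm _).trans hnorm
  have hA : ‖∫ y : ℝ, (poissonKer b y : ℂ) * (g (y * I) * cexp (u * (y * I)))‖ ≤
      2 * (‖g b‖ + (M + 1)) + ε * (‖g b‖ + (M + 1)) + (M * ε + 2) := by
    rw [hsplit, hM']
    refine (norm_sub_le _ _).trans (add_le_add (h2.trans ?_) ((norm_add_le _ _).trans ?_))
    · gcongr
    · refine add_le_add (le_of_eq ?_) h3
      rw [norm_mul, norm_real, norm_real, Real.norm_of_nonneg hM, Real.norm_of_nonneg hε0.le]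
  have hE : Real.exp (u * b) * ε = 1 := by
    rw [hε, ← Real.exp_add, add_neg_cancel, Real.exp_zero]
  have hB : Real.exp (u * b) * ‖g b‖ ≤
      2 * (‖g b‖ + (M + 1)) + ε * (‖g b‖ + (M + 1)) + (M * ε + 2) + Real.exp (u * b) * W := by
    have := norm_sub_norm_le ((Real.exp (u * b) : ℂ) * g b)
      (∫ y : ℝ, (poissonKer b y : ℂ) * (g (y * I) * cexp (u * (y * I))))
    rw [norm_sub_rev, norm_mul, norm_real, Real.norm_of_nonneg (Real.exp_pos _).le] at this
    linarith
  have hC := mul_le_mul_of_nonneg_left hB hε0.le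
  have e1 : ε * (Real.exp (u * b) * ‖g b‖) = ‖g b‖ := by
    linear_combination ‖g b‖ * hE
  have e2 : ε * (2 * (‖g b‖ + (M + 1)) + ε * (‖g b‖ + (M + 1)) + (M * ε + 2) +
      Real.exp (u * b) * W) = ε * (2 + ε) * (‖g b‖ + (M + 1)) + ε * (M * ε + 2) + W := by
    linear_combination W * hE
  rw [e1, e2] at hC
  have h5 : ε * (2 + ε) ≤ 41 / 400 := by nlinarith
  have h6 : ε * (2 + ε) * ‖g b‖ ≤ 41 / 400 * ‖g b‖ := by gcongr
  have h7 : ε * (2 + ε) * (M + 1) ≤ ε * (41 / 20) * (M + 1) := by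
    gcongr
    linarith
  have h8 : ε * (M * ε) ≤ ε * (M * (1 / 20)) := by gcongr
  have h9 : 0 ≤ ε * M := by positivity
  nlinarith

/-- Bound for the integral of the imaginary part along the positive real axis of a function of
moderate growth given by a Dirichlet series, in terms of a lower bound for its real part on the
imaginary axis. -/
theorem TameOn.abs_integral_im_le {g : ℂ → ℂ} (hg : TameOn g) {M : ℝ} (hM : 0 ≤ M)
    (hre : ∀ y : ℝ, -(M + 1 / 2 * Real.log ‖(y * I + 2 : ℂ)‖) ≤ (g (y * I)).re) {a : ℕ → ℂ}
    (hsum : Summable fun n : ℕ => ‖a n‖ * Real.exp (-2 * Real.log n))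
    (ha : ∀ v : ℂ, v.re = 2 → HasSum (fun n : ℕ => a n * cexp (-(Real.log n * v))) (g v))
    {u K : ℝ} (hu : 3 ≤ u) (hK : ∀ b : ℝ, 1 ≤ b → ‖g b‖ ≤ K * Real.exp (-(1 / 2) * b)) :
    |∫ b in Ioi (0 : ℝ), (g b).im| ≤ 6.1 * (M + 1) / u +
      20 * (1 + ∑ n ∈ Finset.range ⌈Real.exp u⌉₊, ‖a n‖) + 2 * K := by
  have hb₀ := fun {b : ℝ} => norm_le_of_three_le hg hM hre hsum ha (u := u) (b := b)
  set W := ∑ n ∈ Finset.range ⌈Real.exp u⌉₊, ‖a n‖ with hW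
  have hW0 : 0 ≤ W := Finset.sum_nonneg fun n _ => norm_nonneg _
  have hu0 : 0 < u := by linarith
  set b₁ := 3 / u with hb₁
  have hub : u * b₁ = 3 := by rw [hb₁]; field_simp
  have hb₁0 : 0 < b₁ := by positivity
  have hb₁1 : b₁ ≤ 1 := by rw [hb₁, div_le_one hu0]; exact hu
  have hcont : ContinuousOn (fun b : ℝ => g b) (Ici 0) := by
    intro b hb
    have h0 := (hg.1 b (by simpa using hb)).continuousAt
    exact (ContinuousAt.comp (g := g) (f := fun y : ℝ => (y : ℂ)) h0
      (by fun_prop)).continuousWithinAt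
  have hcim : ContinuousOn (fun b : ℝ => (g b).im) (Ici 0) :=
    continuous_im.comp_continuousOn hcont
  have hK0 : 0 ≤ K := by
    have := (norm_nonneg _).trans (hK 1 le_rfl)
    exact nonneg_of_mul_nonneg_left this (Real.exp_pos _)
  have iIcc : ∀ {c d : ℝ}, 0 ≤ c → IntegrableOn (fun b : ℝ => (g b).im) (Ioc c d) := by
    intro c d hc
    refine IntegrableOn.mono_set ?_ Ioc_subset_Icc_self
    exact (hcim.mono fun x hx => hc.trans hx.1).integrableOn_Icc
  have hexp := integrableOn_exp_mul_Ioi (show -(1 / 2 : ℝ) < 0 by norm_num) 1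
  have iIoi : IntegrableOn (fun b : ℝ => (g b).im) (Ioi 1) := by
    refine (hexp.const_mul K).mono' ?_ ?_
    · exact (hcim.mono fun x (hx : 1 < x) => zero_le_one.trans hx.le).aestronglyMeasurable
        measurableSet_Ioi
    · filter_upwards [ae_restrict_mem measurableSet_Ioi] with b hb
      exact (abs_im_le_norm _).trans (hK b (le_of_lt hb))
  have hsplit : ∫ b in Ioi (0 : ℝ), (g b).im = (∫ b in Ioc 0 b₁, (g b).im) +
      ((∫ b in Ioc b₁ 1, (g b).im) + ∫ b in Ioi (1 : ℝ), (g b).im) := by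
    rw [← setIntegral_union (Ioc_disjoint_Ioi le_rfl) measurableSet_Ioi (iIcc hb₁0.le) iIoi,
      Ioc_union_Ioi_eq_Ioi hb₁1, ← setIntegral_union (Ioc_disjoint_Ioi le_rfl) measurableSet_Ioi
      (iIcc le_rfl) ?_, Ioc_union_Ioi_eq_Ioi hb₁0.le]
    rw [← Ioc_union_Ioi_eq_Ioi hb₁1]
    exact (iIcc hb₁0.le).union iIoi
  have h3 : |∫ b in Ioi (1 : ℝ), (g b).im| ≤ 2 * K := by
    have : ‖∫ b in Ioi (1 : ℝ), (g b).im‖ ≤ ∫ b in Ioi (1 : ℝ), K * Real.exp (-(1 / 2) * b) := by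
      refine norm_integral_le_of_norm_le (hexp.const_mul K) ?_
      filter_upwards [ae_restrict_mem measurableSet_Ioi] with b hb
      exact (abs_im_le_norm _).trans (hK b (le_of_lt hb))
    rw [integral_const_mul, integral_exp_mul_Ioi (by norm_num)] at this
    refine this.trans ?_
    have h1 : Real.exp (-(1 / 2) * 1) ≤ 1 := Real.exp_le_one_iff.2 (by norm_num)
    have : -Real.exp (-(1 / 2) * 1) / -(1 / 2) ≤ 2 := by linarith
    nlinarith
  have hG1 : ‖g b₁‖ ≤ 3 * (M + 1) * (1 / 20) + 3 * (1 / 20) + 2 * W := by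
    refine (hb₀ hu0.le hb₁0 hb₁1 hub.ge).trans ?_
    have := exp_neg_three_le
    rw [hub]
    gcongr
  have h2 : |∫ b in Ioc b₁ 1, (g b).im| ≤ (3 * (M + 1) + 3) * (1 / 20 / u) + 2 * W := by
    have hi := integrableOn_exp_mul_Ioi (show -u < 0 by linarith) b₁
    have hi1 : IntegrableOn (fun b => Real.exp (-u * b)) (Ioc b₁ 1) := hi.mono_set Ioc_subset_Ioi_self
    have hle : ∫ b in Ioc b₁ 1, Real.exp (-u * b) ≤ 1 / 20 / u := by
      calc ∫ b in Ioc b₁ 1, Real.exp (-u * b) ≤ ∫ b in Ioi b₁, Real.exp (-u * b) :=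
            setIntegral_mono_set hi (Eventually.of_forall fun b => (Real.exp_pos _).le)
              Ioc_subset_Ioi_self.eventuallyLE
        _ = Real.exp (-3) / u := by
            rw [integral_exp_mul_Ioi (by linarith), neg_mul, hub, neg_div_neg_eq]
        _ ≤ _ := by
            have := exp_neg_three_le
            gcongr
    have : ‖∫ b in Ioc b₁ 1, (g b).im‖ ≤
        ∫ b in Ioc b₁ 1, ((3 * (M + 1) + 3) * Real.exp (-u * b) + 2 * W) := by
      refine norm_integral_le_of_norm_le ((hi1.const_mul _).add (integrable_const _)) ?_
      filter_upwards [ae_restrict_mem measurableSet_Ioc] with b hb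
      have h4 : 3 ≤ u * b := by
        rw [← hub]
        exact mul_le_mul_of_nonneg_left hb.1.le hu0.le
      refine ((abs_im_le_norm _).trans (hb₀ hu0.le (hb₁0.trans hb.1) hb.2 h4)).trans (le_of_eq ?_)
      rw [neg_mul]
      ring
    rw [integral_add (hi1.const_mul _) (integrable_const _), integral_const_mul] at this
    have h5 : ∫ b in Ioc b₁ 1, 2 * W ≤ 2 * W := by
      simp only [setIntegral_const, smul_eq_mul, Real.volume_real_Ioc_of_le hb₁1]
      nlinarith
    rw [Real.norm_eq_abs] at this
    have h6 : (3 * (M + 1) + 3) * ∫ b in Ioc b₁ 1, Real.exp (-u * b) ≤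
        (3 * (M + 1) + 3) * (1 / 20 / u) := by gcongr
    linarith
  obtain ⟨l0, l1⟩ := half_log_bounds hb₁0.le hb₁1
  have hval : ∀ {b : ℝ}, 0 ≤ b →
      shifted g M b = g b + (M + 1 / 2 * Real.log (b + 2) : ℝ) := by
    intro b hb
    rw [shifted, log_add_two_ofReal hb]
    push_cast
    ring
  have h1 : |∫ b in Ioc 0 b₁, (g b).im| ≤
      π / 2 * b₁ * (‖g b₁‖ + (M + 1)) + b₁ * ‖g b₁‖ := by
    have h4 := (tameOn_shifted hg M).norm_integral_im_le (shifted_re_nonneg hre) hb₁0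
    have h5 : ∫ b in Ioc 0 b₁, (shifted g M b - shifted g M b₁).im =
        (∫ b in Ioc 0 b₁, (g b).im) - b₁ * (g b₁).im := by
      have h6 : ∫ b in Ioc 0 b₁, (shifted g M b - shifted g M b₁).im =
          ∫ b in Ioc 0 b₁, ((g b).im - (g b₁).im) := by
        refine setIntegral_congr_fun measurableSet_Ioc fun b hb => ?_
        simp only [hval hb.1.le, hval hb₁0.le, sub_im, add_im, ofReal_im, add_zero]
      rw [h6, integral_sub (iIcc le_rfl) (integrable_const _)]
      simp [hb₁0.le]
    have h7 : (shifted g M b₁).re ≤ ‖g b₁‖ + (M + 1) := by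
      rw [hval hb₁0.le, add_re, ofReal_re]
      have := re_le_norm (g b₁)
      linarith
    rw [h5] at h4
    have h8 : |b₁ * (g b₁).im| ≤ b₁ * ‖g b₁‖ := by
      rw [abs_mul, abs_of_pos hb₁0]
      gcongr
      exact abs_im_le_norm _
    have h9 : π / 2 * b₁ * (shifted g M b₁).re ≤ π / 2 * b₁ * (‖g b₁‖ + (M + 1)) := by
      gcongr
    have := abs_sub_abs_le_abs_sub (∫ b in Ioc 0 b₁, (g b).im) (b₁ * (g b₁).im)
    linarith
  have hpi := Real.pi_lt_d4
  set G := ‖g b₁‖ with hG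
  have hG0 : 0 ≤ G := norm_nonneg _
  have h1' : |∫ b in Ioc 0 b₁, (g b).im| ≤
      b₁ * (1.571 * (23 / 20 * (M + 1) + 3 / 20 + 2 * W) +
        (3 / 20 * (M + 1) + 3 / 20 + 2 * W)) := by
    refine h1.trans ?_
    have e1 : π / 2 * b₁ * (G + (M + 1)) ≤ 1.571 * b₁ * (23 / 20 * (M + 1) + 3 / 20 + 2 * W) := by
      have p1 : G + (M + 1) ≤ 23 / 20 * (M + 1) + 3 / 20 + 2 * W := by linarith
      have p2 : π / 2 ≤ 1.571 := by linarith
      exact mul_le_mul (mul_le_mul_of_nonneg_right p2 hb₁0.le) p1 (by positivity) (by positivity)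
    have e2 : b₁ * G ≤ b₁ * (3 / 20 * (M + 1) + 3 / 20 + 2 * W) := by
      refine mul_le_mul_of_nonneg_left ?_ hb₁0.le
      linarith
    linarith
  have h1'' : |∫ b in Ioc 0 b₁, (g b).im| ≤
      (3 * (1.571 * 23 / 20 + 3 / 20)) * ((M + 1) / u) + (2.571 * (3 / 20 + 2 * W)) := by
    refine h1'.trans ?_
    have e3 : b₁ * (M + 1) = 3 * ((M + 1) / u) := by
      rw [hb₁]
      ring
    have e4 : b₁ * (2.571 * (3 / 20 + 2 * W)) ≤ 1 * (2.571 * (3 / 20 + 2 * W)) := by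
      gcongr
    nlinarith
  have h2' : |∫ b in Ioc b₁ 1, (g b).im| ≤ 3 / 20 * ((M + 1) / u) + 1 + 2 * W := by
    refine h2.trans ?_
    have : (3 * (M + 1) + 3) * (1 / 20 / u) = 3 / 20 * ((M + 1) / u) + 3 / 20 / u := by ring
    rw [this]
    have : 3 / 20 / u ≤ 1 := by
      rw [div_le_one hu0]
      linarith
    linarith
  have hP : 0 ≤ (M + 1) / u := by positivity
  rw [hsplit]
  refine (abs_add_le _ _).trans ((add_le_add_right (abs_add_le _ _) _).trans ?_)
  rw [mul_div_assoc]
  linarith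

lemma log_norm_sub_log_norm_add_le {v : ℂ} (hv : 0 < v.re) {δ : ℝ} (h0 : 0 ≤ δ) (h1 : δ ≤ 1) :
    Real.log ‖v‖ - Real.log ‖v + δ‖ ≤
      δ * (Real.log ‖v‖ - Real.log ‖v + 1‖) + δ * (1 / (2 * v.re ^ 2)) := by
  have key : ∀ d : ℝ, ‖v + d‖ ^ 2 = ‖v‖ ^ 2 + 2 * d * v.re + d ^ 2 := by
    intro d
    rw [← Complex.normSq_eq_norm_sq, ← Complex.normSq_eq_norm_sq, Complex.normSq_apply,
      Complex.normSq_apply]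
    simp; ring
  have hx2 : v.re ^ 2 ≤ ‖v‖ ^ 2 := by
    rw [← Complex.normSq_eq_norm_sq, Complex.normSq_apply]; nlinarith [sq_nonneg v.im]
  have hL : ∀ w : ℂ, Real.log ‖w‖ = 1 / 2 * Real.log (‖w‖ ^ 2) := by
    intro w; rw [Real.log_pow]; push_cast; ring
  have hA : 0 < ‖v‖ ^ 2 := by have := pow_pos hv 2; linarith
  have k1 := key 1
  rw [hL v, hL (v + δ), hL (v + 1), key δ, show ‖v + 1‖ ^ 2 = ‖v‖ ^ 2 + 2 * v.re + 1 by
    simpa using k1]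
  set A := ‖v‖ ^ 2
  set x := v.re
  have e1 : Real.log (A + 2 * δ * x) ≤ Real.log (A + 2 * δ * x + δ ^ 2) :=
    Real.log_le_log (by positivity) (by nlinarith)
  have e2 : (1 - δ) * Real.log A + δ * Real.log (A + 2 * x) ≤ Real.log (A + 2 * δ * x) := by
    have := strictConcaveOn_log_Ioi.concaveOn.2 (x := A) (y := A + 2 * x) hA
      (by simp only [mem_Ioi]; positivity) (sub_nonneg.2 h1) h0 (by ring)
    simp only [smul_eq_mul] at this
    refine this.trans_eq ?_
    congr 1; ring
  have e3 : Real.log (A + 2 * x + 1) ≤ Real.log (A + 2 * x) + 1 / x ^ 2 := by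
    have hB : 0 < A + 2 * x := by positivity
    have : Real.log ((A + 2 * x + 1) / (A + 2 * x)) ≤ (A + 2 * x + 1) / (A + 2 * x) - 1 :=
      Real.log_le_sub_one_of_pos (by positivity)
    rw [Real.log_div (by positivity) (by positivity)] at this
    have h2 : (A + 2 * x + 1) / (A + 2 * x) - 1 = 1 / (A + 2 * x) := by field_simp; ring
    have h3 : 1 / (A + 2 * x) ≤ 1 / x ^ 2 := by
      apply one_div_le_one_div_of_le (by positivity); linarith
    linarith
  have e4 := mul_le_mul_of_nonneg_left e3 h0
  have e5 : 1 / (2 * x ^ 2) = 1 / 2 * (1 / x ^ 2) := by field_simp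
  rw [e5]
  nlinarith

lemma norm_GammaSeq_add_le {z : ℂ} (hz : 1 / 8 ≤ z.re) {δ : ℝ} (h0 : 0 ≤ δ) (h1 : δ ≤ 1) {n : ℕ}
    (hn : n ≠ 0) : ‖Complex.GammaSeq (z + δ) n‖ ≤ ‖Complex.GammaSeq z n‖ * ‖z‖ ^ δ *
      Real.exp ((∑' j : ℕ, 1 / (2 * ((j : ℝ) + 1 / 8) ^ 2)) * δ) := by
  have hn' : (0 : ℝ) < n := by positivity
  have hre : ∀ j : ℕ, (j : ℝ) + 1 / 8 ≤ (z + j).re := fun j => by simp; linarith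
  have hpos : ∀ j : ℕ, 0 < (z + j).re := fun j => lt_of_lt_of_le (by positivity) (hre j)
  have hne : ∀ j : ℕ, 0 < ‖z + j‖ := fun j =>
    lt_of_lt_of_le (hpos j) ((le_abs_self _).trans (Complex.abs_re_le_norm _))
  have hne' : ∀ j : ℕ, 0 < ‖z + δ + j‖ := fun j => by
    have : 0 < (z + δ + j).re := by have := hpos j; simp at this ⊢; linarith
    exact lt_of_lt_of_le this ((le_abs_self _).trans (Complex.abs_re_le_norm _))
  have hsum : Summable fun j : ℕ => 1 / (2 * ((j : ℝ) + 1 / 8) ^ 2) := by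
    have := (Real.summable_one_div_nat_add_rpow (1 / 8) 2).2 (by norm_num)
    refine (this.mul_left (1 / 2)).congr fun j => ?_
    rw [abs_of_nonneg (by positivity), ← Real.rpow_natCast]
    field_simp
    norm_num
  have hz0 : 0 < ‖z‖ := by simpa using hne 0
  have P1 : ∏ j ∈ Finset.range (n + 1), ‖z + j‖ =
      Real.exp (∑ j ∈ Finset.range (n + 1), Real.log ‖z + j‖) := by
    rw [Real.exp_sum]; exact Finset.prod_congr rfl fun j _ => (Real.exp_log (hne j)).symm
  have P2 : ∏ j ∈ Finset.range (n + 1), ‖z + δ + j‖ =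
      Real.exp (∑ j ∈ Finset.range (n + 1), Real.log ‖z + δ + j‖) := by
    rw [Real.exp_sum]; exact Finset.prod_congr rfl fun j _ => (Real.exp_log (hne' j)).symm
  have hS : ∑ j ∈ Finset.range (n + 1), (Real.log ‖z + j‖ - Real.log ‖z + δ + j‖) ≤
      δ * (Real.log ‖z‖ - Real.log n) + δ * ∑' j : ℕ, 1 / (2 * ((j : ℝ) + 1 / 8) ^ 2) := by
    calc _ ≤ ∑ j ∈ Finset.range (n + 1), (δ * (Real.log ‖z + j‖ - Real.log ‖z + (j + 1 : ℕ)‖)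
            + δ * (1 / (2 * ((j : ℝ) + 1 / 8) ^ 2))) := by
          refine Finset.sum_le_sum fun j _ => ?_
          have := log_norm_sub_log_norm_add_le (hpos j) h0 h1
          rw [show z + δ + j = z + j + δ by ring, show z + ((j + 1 : ℕ) : ℂ) = z + j + 1 by
            push_cast; ring]
          refine this.trans (add_le_add le_rfl (mul_le_mul_of_nonneg_left ?_ h0))
          apply one_div_le_one_div_of_le (by positivity)
          have := hre j
          gcongr
      _ = δ * (Real.log ‖z‖ - Real.log ‖z + (n + 1 : ℕ)‖) +
            δ * ∑ j ∈ Finset.range (n + 1), 1 / (2 * ((j : ℝ) + 1 / 8) ^ 2) := by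
          rw [Finset.sum_add_distrib, ← Finset.mul_sum, ← Finset.mul_sum,
            Finset.sum_range_sub' (fun j : ℕ => Real.log ‖z + j‖)]
          simp
      _ ≤ _ := by
          gcongr
          · have := (Complex.abs_re_le_norm (z + (n + 1 : ℕ)))
            have h2 := hre (n + 1)
            have h3 := le_abs_self (z + (n + 1 : ℕ)).re
            push_cast at h2 h3 this ⊢
            linarith
          · exact hsum.sum_le_tsum _ fun j _ => by positivity
  unfold Complex.GammaSeq
  rw [norm_div, norm_div, norm_mul, norm_mul, norm_prod, norm_prod,
    Complex.norm_natCast_cpow_of_pos (Nat.pos_of_ne_zero hn),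
    Complex.norm_natCast_cpow_of_pos (Nat.pos_of_ne_zero hn), P1, P2]
  rw [Finset.sum_sub_distrib] at hS
  set S1 := ∑ j ∈ Finset.range (n + 1), Real.log ‖z + j‖
  set S2 := ∑ j ∈ Finset.range (n + 1), Real.log ‖z + δ + j‖
  rw [Real.rpow_def_of_pos hn', Real.rpow_def_of_pos hn', Real.rpow_def_of_pos hz0]
  rw [div_eq_mul_inv, div_eq_mul_inv, ← Real.exp_neg, ← Real.exp_neg]
  have : ∀ a b c d e f : ℝ, a - b ≤ -c + d + e + f → Real.exp a * ‖((n.factorial : ℕ) : ℂ)‖ * Real.exp (-b)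
      ≤ Real.exp (d) * ‖((n.factorial : ℕ) : ℂ)‖ * Real.exp (-c) * Real.exp e * Real.exp f := by
    intro a b c d e f h
    calc _ = Real.exp (a - b) * ‖((n.factorial : ℕ) : ℂ)‖ := by rw [sub_eq_add_neg, Real.exp_add]; ring
      _ ≤ Real.exp (-c + d + e + f) * ‖((n.factorial : ℕ) : ℂ)‖ := by gcongr
      _ = _ := by rw [Real.exp_add, Real.exp_add, Real.exp_add]; ring
  apply this
  simp only [Complex.add_re, Complex.ofReal_re]
  linarith

theorem exists_norm_Gamma_add_le : ∃ K : ℝ, 0 ≤ K ∧ ∀ (z : ℂ) (δ : ℝ), 1 / 8 ≤ z.re → 0 ≤ δ → δ ≤ 1 →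
    ‖Complex.Gamma (z + δ)‖ ≤ ‖Complex.Gamma z‖ * ‖z‖ ^ δ * Real.exp (K * δ) := by
  refine ⟨∑' j : ℕ, 1 / (2 * ((j : ℝ) + 1 / 8) ^ 2), tsum_nonneg fun j => by positivity,
    fun z δ hz h0 h1 => ?_⟩
  refine le_of_tendsto_of_tendsto (Complex.GammaSeq_tendsto_Gamma (z + δ)).norm
    (((Complex.GammaSeq_tendsto_Gamma z).norm.mul_const _).mul_const _) ?_
  filter_upwards [eventually_ne_atTop 0] with n hn using norm_GammaSeq_add_le hz h0 h1 hn

/-- The truncated character sum, as a function on the reals supported on `(1, ∞)`. -/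
noncomputable def charSum {q : ℕ} (χ : DirichletCharacter ℂ q) : ℝ → ℂ :=
  (Ioi (1 : ℝ)).indicator fun t => ∑ k ∈ Finset.Icc 1 ⌊t⌋₊, χ (k : ZMod q)

lemma measurable_charSum {q : ℕ} (χ : DirichletCharacter ℂ q) : Measurable (charSum χ) := by
  refine Measurable.indicator ?_ measurableSet_Ioi
  exact (measurable_from_nat (f := fun n : ℕ => ∑ k ∈ Finset.Icc 1 n, χ (k : ZMod q))).comp
    Nat.measurable_floor

section CharacterSums

variable {q : ℕ} [NeZero q] {χ : DirichletCharacter ℂ q}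

lemma sum_range_eq_zero_of_ne_one (hχ : χ ≠ 1) : ∑ k ∈ Finset.range q, χ (k : ZMod q) = 0 := by
  rw [← χ.sum_eq_zero_of_ne_one hχ]
  refine Finset.sum_nbij (fun k => (k : ZMod q)) (fun _ _ => Finset.mem_univ _) ?_ ?_ fun _ _ => rfl
  · intro a ha b hb h
    have := (ZMod.natCast_eq_natCast_iff' a b q).1 h
    rwa [Nat.mod_eq_of_lt (by simpa using ha), Nat.mod_eq_of_lt (by simpa using hb)] at this
  · intro a _
    exact ⟨a.val, by simpa using ZMod.val_lt a, ZMod.natCast_zmod_val a⟩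

lemma sum_range_add_modulus (hχ : χ ≠ 1) (n : ℕ) :
    ∑ k ∈ Finset.range (n + q), χ (k : ZMod q) = ∑ k ∈ Finset.range n, χ (k : ZMod q) := by
  induction n with
  | zero => simpa using sum_range_eq_zero_of_ne_one hχ
  | succ n ih =>
    rw [add_right_comm, Finset.sum_range_succ, Finset.sum_range_succ, ih]
    simp

lemma norm_sum_range_le (hχ : χ ≠ 1) (n : ℕ) : ‖∑ k ∈ Finset.range n, χ (k : ZMod q)‖ ≤ q := by
  induction n using Nat.strong_induction_on with
  | _ n ih =>
    rcases lt_or_ge n q with h | h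
    · refine (norm_sum_le_of_le _ fun k _ => χ.norm_le_one _).trans ?_
      simpa using h.le
    · obtain ⟨m, rfl⟩ := Nat.exists_eq_add_of_le' h
      rw [sum_range_add_modulus hχ]
      exact ih m (by have := NeZero.pos q; omega)

lemma norm_sum_Icc_le (hχ : χ ≠ 1) (n : ℕ) :
    ‖∑ k ∈ Finset.Icc 1 n, χ (k : ZMod q)‖ ≤ q + 1 := by
  have : ∑ k ∈ Finset.Icc 1 n, χ (k : ZMod q) =
      ∑ k ∈ Finset.range (n + 1), χ (k : ZMod q) - χ 0 := by
    rw [Finset.range_eq_Ico, Finset.sum_eq_sum_Ico_succ_bot (by omega)]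
    simp [Finset.Ico_add_one_right_eq_Icc]
  rw [this]
  exact (norm_sub_le _ _).trans (add_le_add (norm_sum_range_le hχ _) (χ.norm_le_one _))

lemma norm_charSum_le (hχ : χ ≠ 1) (t : ℝ) : ‖charSum χ t‖ ≤ q + 1 := by
  unfold charSum
  exact (norm_indicator_le_norm_self _ _).trans (norm_sum_Icc_le hχ _)

lemma differentiableAt_mellin_charSum (hχ : χ ≠ 1) {s : ℂ} (hs : s.re < 0) :
    DifferentiableAt ℂ (mellin (charSum χ)) s := by
  refine mellin_differentiableAt_of_isBigO_rpow (a := 0) (b := s.re - 1) ?_ ?_ hs ?_ (by linarith)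
  · refine LocallyIntegrable.locallyIntegrableOn ?_ _
    refine (locallyIntegrable_const ((q : ℝ) + 1)).mono (measurable_charSum χ).aestronglyMeasurable ?_
    refine Eventually.of_forall fun t => (norm_charSum_le hχ t).trans ?_
    exact le_abs_self _
  · refine Asymptotics.IsBigO.of_bound (q + 1) (Eventually.of_forall fun t => ?_)
    simpa using norm_charSum_le hχ t
  · refine Asymptotics.IsBigO.of_bound 1 ?_
    have : Ioo (0 : ℝ) 1 ∈ 𝓝[>] (0 : ℝ) := Ioo_mem_nhdsGT one_pos
    filter_upwards [this] with t ht
    have : charSum χ t = 0 := indicator_of_notMem (by simpa using ht.2.le) _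
    rw [this]
    simp

lemma norm_mellin_charSum_le (hχ : χ ≠ 1) {s : ℂ} (hs : 0 < s.re) :
    ‖mellin (charSum χ) (-s)‖ ≤ (q + 1) / s.re := by
  have e : mellin (charSum χ) (-s) = ∫ t in Ioi (1 : ℝ),
      (t : ℂ) ^ (-s - 1) * ∑ k ∈ Finset.Icc 1 ⌊t⌋₊, χ (k : ZMod q) := by
    unfold mellin
    rw [← integral_indicator measurableSet_Ioi, ← integral_indicator measurableSet_Ioi]
    congr 1
    ext t
    by_cases ht : t ∈ Ioi (1 : ℝ)
    · have h0 : t ∈ Ioi (0 : ℝ) := zero_lt_one.trans (mem_Ioi.1 ht)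
      rw [indicator_of_mem h0, indicator_of_mem ht, charSum, indicator_of_mem ht, smul_eq_mul]
    · rw [indicator_of_notMem ht, charSum]
      by_cases h0 : t ∈ Ioi (0 : ℝ)
      · rw [indicator_of_mem h0, indicator_of_notMem ht, smul_zero]
      · rw [indicator_of_notMem h0]
  have hi : IntegrableOn (fun t : ℝ => (q + 1) * t ^ (-s.re - 1)) (Ioi 1) :=
    (integrableOn_Ioi_rpow_of_lt (by linarith) one_pos).const_mul _
  rw [e]
  refine (norm_integral_le_of_norm_le hi ?_).trans_eq ?_
  · refine (ae_restrict_iff' measurableSet_Ioi).2 (Eventually.of_forall fun t ht => ?_)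
    have h0 : (0 : ℝ) < t := lt_trans zero_lt_one ht
    rw [norm_mul, Complex.norm_cpow_eq_rpow_re_of_pos h0, mul_comm]
    simp only [Complex.sub_re, Complex.neg_re, Complex.one_re]
    exact mul_le_mul_of_nonneg_right (norm_sum_Icc_le hχ _) (by positivity)
  · rw [integral_const_mul, integral_Ioi_rpow_of_lt (by linarith) one_pos]
    simp only [Real.one_rpow]
    have : -s.re - 1 + 1 = -s.re := by ring
    rw [this]
    field_simp

theorem LFunction_eq_mul_mellin (hχ : χ ≠ 1) {s : ℂ} (hs : 0 < s.re) :
    DirichletCharacter.LFunction χ s = s * mellin (charSum χ) (-s) := by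
  have hU : IsOpen {s : ℂ | 0 < s.re} := isOpen_lt continuous_const Complex.continuous_re
  refine AnalyticOnNhd.eqOn_of_preconnected_of_eventuallyEq (𝕜 := ℂ)
    (U := {s : ℂ | 0 < s.re}) (f := DirichletCharacter.LFunction χ)
    (g := fun s => s * mellin (charSum χ) (-s)) (z₀ := 2) ?_ ?_ ?_ (by simp) ?_ hs
  · exact (DirichletCharacter.differentiable_LFunction hχ).differentiableOn.analyticOnNhd hU
  · refine DifferentiableOn.analyticOnNhd (fun z hz => ?_) hU
    have : DifferentiableAt ℂ (fun s => mellin (charSum χ) (-s)) z :=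
      DifferentiableAt.comp (g := mellin (charSum χ)) (f := fun s => -s) z
        (differentiableAt_mellin_charSum (s := -z) hχ (by simpa using hz))
        differentiableAt_id.neg
    exact (differentiableAt_id.mul this).differentiableWithinAt
  · exact (convex_halfSpace_re_gt 0).isPreconnected
  · have : {s : ℂ | 1 < s.re} ∈ 𝓝 (2 : ℂ) :=
      (isOpen_lt continuous_const Complex.continuous_re).mem_nhds (by simp)
    filter_upwards [this] with z hz
    have hz' : 1 < z.re := hz
    rw [DirichletCharacter.LFunction_eq_LSeries χ hz', LSeries_eq_mul_integral _ le_rfl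
      (by linarith) ((DirichletCharacter.LSeriesSummable_iff (NeZero.ne q) χ).2 hz')]
    · congr 1
      unfold mellin
      rw [← integral_indicator measurableSet_Ioi, ← integral_indicator measurableSet_Ioi]
      congr 1
      ext t
      by_cases ht : t ∈ Ioi (1 : ℝ)
      · have h0 : t ∈ Ioi (0 : ℝ) := zero_lt_one.trans (mem_Ioi.1 ht)
        rw [indicator_of_mem h0, indicator_of_mem ht, charSum, indicator_of_mem ht, smul_eq_mul,
          mul_comm]
        ring_nf
      · rw [indicator_of_notMem ht, charSum]
        by_cases h0 : t ∈ Ioi (0 : ℝ)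
        · rw [indicator_of_mem h0, indicator_of_notMem ht, smul_zero]
        · rw [indicator_of_notMem h0]
    · refine Asymptotics.IsBigO.of_bound (q + 1) (Eventually.of_forall fun n => ?_)
      simpa using norm_sum_Icc_le hχ n

theorem norm_LFunction_le (hχ : χ ≠ 1) {s : ℂ} (hs : 1 / 4 ≤ s.re) :
    ‖DirichletCharacter.LFunction χ s‖ ≤ 4 * (q + 1) * ‖s‖ := by
  rw [LFunction_eq_mul_mellin hχ (by linarith), norm_mul, mul_comm]
  refine mul_le_mul_of_nonneg_right ?_ (norm_nonneg _)
  refine (norm_mellin_charSum_le hχ (by linarith)).trans ?_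
  rw [div_le_iff₀ (by linarith)]
  nlinarith [(Nat.cast_nonneg q : (0 : ℝ) ≤ q)]

end CharacterSums

lemma exists_gammaFactor {q : ℕ} (χ : DirichletCharacter ℂ q) : ∃ κ : ℝ, 0 ≤ κ ∧ κ ≤ 1 ∧
    (∀ s, χ.gammaFactor s = Gammaℝ (s + κ)) ∧ ∀ s, χ⁻¹.gammaFactor s = Gammaℝ (s + κ) := by
  have hinv : χ⁻¹ (-1) = (χ (-1))⁻¹ := by rw [MulChar.inv_apply_eq_inv']
  rcases χ.even_or_odd with h | h
  · have h' : χ⁻¹.Even := by rw [DirichletCharacter.Even, hinv, h]; simp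
    exact ⟨0, le_rfl, zero_le_one, fun s => by rw [h.gammaFactor_def]; simp,
      fun s => by rw [h'.gammaFactor_def]; simp⟩
  · have h' : χ⁻¹.Odd := by rw [DirichletCharacter.Odd, hinv, h]; norm_num
    exact ⟨1, zero_le_one, le_rfl, fun s => by rw [h.gammaFactor_def]; simp,
      fun s => by rw [h'.gammaFactor_def]; simp⟩

lemma gammaFactor_ne_zero {q : ℕ} (χ : DirichletCharacter ℂ q) {s : ℂ} (hs : 0 < s.re) :
    χ.gammaFactor s ≠ 0 := by
  obtain ⟨κ, h0, -, h, -⟩ := exists_gammaFactor χ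
  rw [h]
  exact Gammaℝ_ne_zero_of_re_pos (by simp; linarith)

section FunctionalEquation

variable {q : ℕ} [NeZero q] {χ : DirichletCharacter ℂ q}

theorem conj_LFunction_conj (hχ : χ ≠ 1) (s : ℂ) :
    (starRingEnd ℂ) (DirichletCharacter.LFunction χ ((starRingEnd ℂ) s)) =
      DirichletCharacter.LFunction χ⁻¹ s := by
  have hχ' : χ⁻¹ ≠ 1 := inv_ne_one.2 hχ
  have h1 : Differentiable ℂ fun s =>
      (starRingEnd ℂ) (DirichletCharacter.LFunction χ ((starRingEnd ℂ) s)) := fun s => by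
    have := (DirichletCharacter.differentiable_LFunction hχ ((starRingEnd ℂ) s)).conj_conj
    simpa [Function.comp_def] using this
  refine congr_fun (AnalyticOnNhd.eq_of_eventuallyEq (𝕜 := ℂ) (z₀ := 2)
    (f := fun s => (starRingEnd ℂ) (DirichletCharacter.LFunction χ ((starRingEnd ℂ) s)))
    (g := DirichletCharacter.LFunction χ⁻¹)
    (h1.differentiableOn.analyticOnNhd isOpen_univ)
    ((DirichletCharacter.differentiable_LFunction hχ').differentiableOn.analyticOnNhd isOpen_univ)
    ?_) s
  have : {s : ℂ | 1 < s.re} ∈ 𝓝 (2 : ℂ) :=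
    (isOpen_lt continuous_const Complex.continuous_re).mem_nhds (by simp)
  filter_upwards [this] with z hz
  have hz' : 1 < z.re := hz
  rw [DirichletCharacter.LFunction_eq_LSeries χ (by simpa using hz'),
    DirichletCharacter.LFunction_eq_LSeries χ⁻¹ hz', LSeries, LSeries, Complex.conj_tsum]
  congr 1
  ext n
  rcases eq_or_ne n 0 with rfl | hn
  · simp
  · rw [LSeries.term_of_ne_zero hn, LSeries.term_of_ne_zero hn, map_div₀, ← MulChar.star_apply' χ]
    congr 1
    rw [← Complex.conj_cpow _ _ (by rw [Complex.natCast_arg]; exact Real.pi_pos.ne),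
      Complex.conj_natCast]

theorem norm_LFunction_inv_conj (hχ : χ ≠ 1) (s : ℂ) :
    ‖DirichletCharacter.LFunction χ⁻¹ ((starRingEnd ℂ) s)‖ =
      ‖DirichletCharacter.LFunction χ s‖ := by
  rw [← conj_LFunction_conj hχ, Complex.conj_conj, RCLike.norm_conj]

lemma norm_Gammaℝ_conj (s : ℂ) : ‖Gammaℝ ((starRingEnd ℂ) s)‖ = ‖Gammaℝ s‖ := by
  have h1 : (starRingEnd ℂ) s / 2 = (starRingEnd ℂ) (s / 2) := by simp [map_ofNat]
  rw [Gammaℝ_def, Gammaℝ_def, norm_mul, norm_mul, h1, Complex.Gamma_conj, RCLike.norm_conj,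
    Complex.norm_cpow_eq_rpow_re_of_pos Real.pi_pos, Complex.norm_cpow_eq_rpow_re_of_pos Real.pi_pos]
  simp

lemma completedLFunction_eq_mul (χ : DirichletCharacter ℂ q) {s : ℂ} (hs : 0 < s.re) :
    χ.completedLFunction s = χ.LFunction s * χ.gammaFactor s := by
  have : s ≠ 0 := by rintro rfl; simp at hs
  rw [DirichletCharacter.LFunction_eq_completed_div_gammaFactor χ s (Or.inl this),
    div_mul_cancel₀ _ (gammaFactor_ne_zero χ hs)]

lemma norm_completedLFunction_inv_conj (hχ : χ ≠ 1) {s : ℂ} (hs : 0 < s.re) :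
    ‖χ⁻¹.completedLFunction ((starRingEnd ℂ) s)‖ = ‖χ.completedLFunction s‖ := by
  obtain ⟨κ, -, -, h, h'⟩ := exists_gammaFactor χ
  rw [completedLFunction_eq_mul _ hs, completedLFunction_eq_mul _ (by simpa using hs), norm_mul,
    norm_mul, norm_LFunction_inv_conj hχ, h, h', ← norm_Gammaℝ_conj (s + κ)]
  simp

lemma ne_one_of_isPrimitive (hq : 1 < q) (hχ : χ.IsPrimitive) : χ ≠ 1 := by
  rintro rfl
  rw [DirichletCharacter.isPrimitive_def, DirichletCharacter.conductor_one] at hχ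
  omega

theorem LFunction_ne_zero_of_half_lt_re (hχ : χ ≠ 1) (hG : GRH χ) {s : ℂ} (hs : 1 / 2 < s.re) :
    DirichletCharacter.LFunction χ s ≠ 0 := by
  intro h
  rcases lt_or_ge s.re 1 with h1 | h1
  · linarith [hG s h (by linarith) h1]
  · exact DirichletCharacter.LFunction_ne_zero_of_one_le_re χ (Or.inl hχ) h1 h

lemma norm_completedLFunction_sub (hq : 1 < q) (hχ : χ.IsPrimitive) {δ : ℝ} (h1 : -(1 / 2) < δ)
    (t : ℝ) :
    ‖χ.completedLFunction (1 / 2 - δ + t * I)‖ =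
      (q : ℝ) ^ δ * ‖χ.rootNumber‖ * ‖χ.completedLFunction (1 / 2 + δ + t * I)‖ := by
  have hχ1 := ne_one_of_isPrimitive hq hχ
  have hq0 : (0 : ℝ) < q := by positivity
  have := hχ.completedLFunction_one_sub (1 / 2 + δ - t * I)
  rw [show (1 : ℂ) - (1 / 2 + δ - t * I) = 1 / 2 - δ + t * I by ring,
    show (1 / 2 + δ - t * I : ℂ) = (starRingEnd ℂ) (1 / 2 + δ + t * I) by
      simp [sub_eq_add_neg, map_ofNat]] at this
  rw [this, norm_mul, norm_mul, norm_completedLFunction_inv_conj hχ1 (by simp; linarith),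
    Complex.norm_natCast_cpow_of_pos (by omega)]
  simp

theorem norm_rootNumber (hq : 1 < q) (hχ : χ.IsPrimitive) (hG : GRH χ) : ‖χ.rootNumber‖ = 1 := by
  have hχ1 := ne_one_of_isPrimitive hq hχ
  have hq0 : (0 : ℝ) < q := by positivity
  have e1 := norm_completedLFunction_sub hq hχ (δ := 1 / 4) (by norm_num) 0
  have e2 := norm_completedLFunction_sub hq hχ (δ := -(1 / 4)) (by norm_num) 0
  have e3 : χ.completedLFunction (1 / 2 + (1 / 4 : ℝ) + (0 : ℝ) * I) ≠ 0 := by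
    rw [completedLFunction_eq_mul _ (by norm_num)]
    exact mul_ne_zero (LFunction_ne_zero_of_half_lt_re hχ1 hG (by norm_num))
      (gammaFactor_ne_zero χ (by norm_num))
  have e4 : (1 / 2 - ((-(1 / 4) : ℝ) : ℂ) + (0 : ℝ) * I) = 1 / 2 + (1 / 4 : ℝ) + (0 : ℝ) * I := by
    push_cast; ring
  have e5 : (1 / 2 + ((-(1 / 4) : ℝ) : ℂ) + (0 : ℝ) * I) = 1 / 2 - (1 / 4 : ℝ) + (0 : ℝ) * I := by
    push_cast; ring
  rw [e4, e5, e1, Real.rpow_neg hq0.le] at e2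
  have e6 := norm_pos_iff.2 e3
  have e7 : (0 : ℝ) < (q : ℝ) ^ (1 / 4 : ℝ) := by positivity
  set A := ‖χ.completedLFunction (1 / 2 + (1 / 4 : ℝ) + (0 : ℝ) * I)‖
  field_simp at e2
  have e8 : ‖χ.rootNumber‖ ^ 2 = 1 := by nlinarith
  nlinarith [norm_nonneg χ.rootNumber]

end FunctionalEquation

theorem exists_norm_LFunction_sub_le : ∃ K : ℝ, 0 ≤ K ∧ ∀ (q : ℕ) [NeZero q]
    (χ : DirichletCharacter ℂ q), 1 < q → χ.IsPrimitive → GRH χ → ∀ δ t : ℝ, 0 ≤ δ → δ ≤ 1 / 4 →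
    ‖χ.LFunction (1 / 2 - δ + t * I)‖ ≤
      (q * Real.exp K * ‖(t * I + 2 : ℂ)‖) ^ δ * ‖χ.LFunction (1 / 2 + δ + t * I)‖ := by
  obtain ⟨K, hK, hΓ⟩ := exists_norm_Gamma_add_le
  refine ⟨K, hK, fun q _ χ hq hχ hG δ t h0 h1 => ?_⟩
  have hq0 : (0 : ℝ) < q := by positivity
  have h := norm_completedLFunction_sub hq hχ (δ := δ) (by linarith) t
  rw [norm_rootNumber hq hχ hG, mul_one, completedLFunction_eq_mul _ (by simp; linarith),
    completedLFunction_eq_mul _ (by simp; linarith), norm_mul, norm_mul] at h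
  have hγ := norm_pos_iff.2 (gammaFactor_ne_zero χ (s := 1 / 2 - δ + t * I) (by simp; linarith))
  suffices H : ‖χ.gammaFactor (1 / 2 + δ + t * I)‖ ≤
      ‖χ.gammaFactor (1 / 2 - δ + t * I)‖ * (Real.exp K * ‖(t * I + 2 : ℂ)‖) ^ δ by
    rw [← mul_le_mul_iff_left₀ hγ, h, mul_assoc (q : ℝ), Real.mul_rpow hq0.le (by positivity)]
    calc _ ≤ (q : ℝ) ^ δ * (‖χ.LFunction (1 / 2 + δ + t * I)‖ *
        (‖χ.gammaFactor (1 / 2 - δ + t * I)‖ * (Real.exp K * ‖(t * I + 2 : ℂ)‖) ^ δ)) := by gcongr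
      _ = _ := by ring
  obtain ⟨κ, hκ0, hκ1, hκ, -⟩ := exists_gammaFactor χ
  rw [hκ, hκ, Gammaℝ_def, Gammaℝ_def, norm_mul, norm_mul]
  set z : ℂ := (1 / 2 - δ + t * I + κ) / 2 with hz
  have hzre : z.re = (1 / 2 - δ + κ) / 2 := by simp [hz]
  have hzim : z.im = t / 2 := by simp [hz]
  rw [show (1 / 2 + δ + t * I + κ) / 2 = z + δ by rw [hz]; ring,
    Complex.norm_cpow_eq_rpow_re_of_pos Real.pi_pos, Complex.norm_cpow_eq_rpow_re_of_pos Real.pi_pos]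
  have hzn : ‖z‖ ≤ ‖(t * I + 2 : ℂ)‖ := by
    rw [← sq_le_sq₀ (norm_nonneg _) (norm_nonneg _), ← Complex.normSq_eq_norm_sq,
      ← Complex.normSq_eq_norm_sq, Complex.normSq_apply, Complex.normSq_apply, hzre, hzim]
    simp
    nlinarith [sq_nonneg t]
  have hG1 := hΓ z δ (by rw [hzre]; linarith) h0 (by linarith)
  have hpi : π ^ (-(1 / 2 + δ + t * I + κ : ℂ) / 2).re ≤ π ^ (-(1 / 2 - δ + t * I + κ : ℂ) / 2).re := by
    apply Real.rpow_le_rpow_of_exponent_le (by linarith [Real.pi_gt_three])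
    simp
    linarith
  rw [Real.mul_rpow (Real.exp_pos _).le (norm_nonneg _), ← Real.exp_mul]
  calc _ ≤ π ^ (-(1 / 2 - δ + t * I + κ : ℂ) / 2).re *
        (‖Complex.Gamma z‖ * ‖(t * I + 2 : ℂ)‖ ^ δ * Real.exp (K * δ)) := by
        gcongr
        exact hG1.trans (by gcongr)
    _ = _ := by ring

theorem exists_log_on_ball {f : ℂ → ℂ} {c : ℂ} {R : ℝ} (hR : 0 < R)
    (hf : DifferentiableOn ℂ f (Metric.ball c R)) (h0 : ∀ z ∈ Metric.ball c R, f z ≠ 0) :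
    ∃ ℓ : ℂ → ℂ, ℓ c = 0 ∧ (∀ z ∈ Metric.ball c R, HasDerivAt ℓ (logDeriv f z) z) ∧
      ∀ z ∈ Metric.ball c R, f z = f c * cexp (ℓ z) := by
  have hc : c ∈ Metric.ball c R := Metric.mem_ball_self hR
  have hd : ∀ z ∈ Metric.ball c R, DifferentiableAt ℂ f z := fun z hz =>
    (hf z hz).differentiableAt (Metric.isOpen_ball.mem_nhds hz)
  have hld : DifferentiableOn ℂ (logDeriv f) (Metric.ball c R) := fun z hz =>
    ((hf.deriv Metric.isOpen_ball) z hz).div (hf z hz) (h0 z hz)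
  obtain ⟨ℓ, hℓ0, hℓ⟩ := hld.isExactOn_ball.with_val_at c 0
  refine ⟨ℓ, hℓ0, hℓ, ?_⟩
  have hder : ∀ z ∈ Metric.ball c R, HasDerivAt (fun z => f z * cexp (-ℓ z)) 0 z := by
    intro z hz
    convert! (hd z hz).hasDerivAt.mul (hℓ z hz).neg.cexp using 1
    rw [logDeriv_apply]
    field_simp [h0 z hz]
    ring
  intro z hz
  have := (convex_ball c R).is_const_of_fderivWithin_eq_zero (𝕜 := ℂ) (f := fun z => f z * cexp (-ℓ z))
    (fun w hw => (hder w hw).differentiableAt.differentiableWithinAt) (fun w hw => ?_) hz hc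
  · simp only [hℓ0, neg_zero, Complex.exp_zero, mul_one] at this
    rw [← this, mul_assoc, ← Complex.exp_add]
    simp
  · rw [fderivWithin_of_isOpen Metric.isOpen_ball hw]
    ext
    simp [(hder w hw).deriv]

theorem log_control_of_ne_zero {f : ℂ → ℂ} {c : ℂ} {R B : ℝ} (hR : 0 < R) (hB : 1 < B)
    (hf : DifferentiableOn ℂ f (Metric.ball c R)) (h0 : ∀ z ∈ Metric.ball c R, f z ≠ 0)
    (hfB : ∀ z ∈ Metric.ball c R, ‖f z‖ ≤ B * ‖f c‖) :
    ∃ ℓ : ℂ → ℂ, (∀ z ∈ Metric.ball c R, HasDerivAt ℓ (logDeriv f z) z) ∧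
      (∀ z ∈ Metric.ball c R, f z = f c * cexp (ℓ z)) ∧
      ∀ r < R, ∀ z, ‖z - c‖ ≤ r → ‖ℓ z‖ ≤ 2 * Real.log B * r / (R - r) := by
  have hc : c ∈ Metric.ball c R := Metric.mem_ball_self hR
  obtain ⟨ℓ, hℓ0, hℓ, hexp⟩ := exists_log_on_ball hR hf h0
  refine ⟨ℓ, hℓ, hexp, fun r hr z hz => ?_⟩
  have hlog : 0 < Real.log B := Real.log_pos hB
  have hfc := norm_pos_iff.2 (h0 c hc)
  have hmem : ∀ w ∈ Metric.ball (0 : ℂ) R, c + w ∈ Metric.ball c R := by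
    intro w hw; simpa using hw
  have hzr : 0 ≤ r := (norm_nonneg _).trans hz
  have := Complex.borelCaratheodory_zero (f := fun w => ℓ (c + w)) (M := Real.log B) (R := R)
    (z := z - c) hlog ?_ ?_ hR (by simpa using hz.trans_lt hr) (by simpa using hℓ0)
  · simp only [add_sub_cancel] at this
    refine this.trans ?_
    have h1 : 0 < R - r := by linarith
    gcongr
  · intro w hw
    exact ((hℓ _ (hmem w hw)).differentiableAt.comp w
      (differentiableAt_id.const_add c)).differentiableWithinAt
  · intro w hw
    have h1 := hfB _ (hmem w hw)
    rw [hexp _ (hmem w hw), norm_mul, mul_comm, Complex.norm_exp] at h1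
    have h2 := le_of_mul_le_mul_right h1 hfc
    exact (Real.le_log_iff_exp_le (by linarith)).2 h2

theorem norm_and_logDeriv_bounds {f : ℂ → ℂ} {c z : ℂ} {R B r ρ : ℝ} (hr : 0 ≤ r) (hρ : 0 < ρ)
    (hrR : r + ρ < R) (hB : 1 < B) (hf : DifferentiableOn ℂ f (Metric.ball c R))
    (h0 : ∀ z ∈ Metric.ball c R, f z ≠ 0)
    (hfB : ∀ z ∈ Metric.ball c R, ‖f z‖ ≤ B * ‖f c‖) (hz : ‖z - c‖ ≤ r) :
    ‖f c‖ * Real.exp (-(2 * Real.log B * r / (R - r))) ≤ ‖f z‖ ∧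
      ‖logDeriv f z‖ ≤ 2 * Real.log B * (r + ρ) / (R - (r + ρ)) / ρ := by
  obtain ⟨ℓ, hℓ, hexp, hb⟩ := log_control_of_ne_zero (by linarith) hB hf h0 hfB
  have hzm : z ∈ Metric.ball c R := by rw [mem_ball_iff_norm]; linarith
  constructor
  · rw [hexp z hzm, norm_mul, Complex.norm_exp]
    gcongr
    have := hb r (by linarith) z hz
    have h2 := Complex.abs_re_le_norm (ℓ z)
    linarith [neg_abs_le (ℓ z).re]
  · rw [← (hℓ z hzm).deriv]
    have hsub : ∀ w, ‖w - z‖ ≤ ρ → ‖w - c‖ ≤ r + ρ := fun w hw => by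
      have := norm_sub_le_norm_sub_add_norm_sub w z c
      linarith
    refine Complex.norm_deriv_le_of_forall_mem_sphere_norm_le hρ ?_ fun w hw =>
      hb _ hrR w (hsub w (mem_sphere_iff_norm.1 hw).le)
    refine DifferentiableOn.diffContOnCl fun w hw => ?_
    have hw' := Metric.closure_ball_subset_closedBall hw
    have := hsub w (mem_closedBall_iff_norm.1 hw')
    exact (hℓ w (by rw [mem_ball_iff_norm]; linarith)).differentiableAt.differentiableWithinAt

section

variable {q : ℕ} [NeZero q] {χ : DirichletCharacter ℂ q}

theorem norm_LFunction_sub_one_le (χ : DirichletCharacter ℂ q) {s : ℂ} (hs : 2 ≤ s.re) :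
    ‖χ.LFunction s - 1‖ ≤ 2 / 3 := by
  rw [DirichletCharacter.LFunction_eq_LSeries χ (by linarith)]
  have hsum := (DirichletCharacter.LSeriesSummable_iff (NeZero.ne q) χ).2 (by linarith : 1 < s.re)
  have hb : ∀ n : ℕ, ‖LSeries.term (fun n => χ n) s n‖ ≤ 1 / (n : ℝ) ^ 2 := by
    intro n
    rcases eq_or_ne n 0 with rfl | hn
    · simp
    · rw [LSeries.term_of_ne_zero hn, norm_div, Complex.norm_natCast_cpow_of_pos (Nat.pos_of_ne_zero hn)]
      have h1 : (1 : ℝ) ≤ n := by exact_mod_cast Nat.one_le_iff_ne_zero.2 hn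
      have : (n : ℝ) ^ (2 : ℕ) ≤ (n : ℝ) ^ s.re := by
        rw [← Real.rpow_natCast]
        exact Real.rpow_le_rpow_of_exponent_le h1 (by simpa using hs)
      have h2 := χ.norm_le_one (n : ZMod q)
      gcongr
  have h2 := hasSum_zeta_two
  have e1 : LSeries (fun n => χ n) s = 1 + ∑' n, LSeries.term (fun n => χ n) s (n + 2) := by
    rw [LSeries, ← hsum.sum_add_tsum_nat_add 2, Finset.sum_range_succ, Finset.sum_range_one]
    simp [LSeries.term_of_ne_zero]
  have e2 : ∑' n : ℕ, 1 / ((n + 2 : ℕ) : ℝ) ^ 2 = π ^ 2 / 6 - 1 := by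
    have := h2.summable.sum_add_tsum_nat_add 2
    rw [h2.tsum_eq, Finset.sum_range_succ, Finset.sum_range_one] at this
    norm_num at this ⊢
    linarith
  have hs2 : Summable fun n : ℕ => 1 / ((n + 2 : ℕ) : ℝ) ^ 2 :=
    (summable_nat_add_iff 2).2 h2.summable
  have e3 : ‖∑' n, LSeries.term (fun n => χ n) s (n + 2)‖ ≤ π ^ 2 / 6 - 1 := by
    rw [← e2]
    exact tsum_of_norm_bounded hs2.hasSum fun n => hb (n + 2)
  have hpi : π ^ 2 / 6 - 1 ≤ 2 / 3 := by nlinarith [Real.pi_lt_d2, Real.pi_pos]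
  rw [e1, add_sub_cancel_left]
  exact e3.trans hpi

theorem one_third_le_norm_LFunction (χ : DirichletCharacter ℂ q) {s : ℂ} (hs : 2 ≤ s.re) :
    1 / 3 ≤ ‖χ.LFunction s‖ := by
  have h1 := norm_LFunction_sub_one_le χ hs
  have h2 := norm_sub_le (χ.LFunction s) (χ.LFunction s - 1)
  rw [sub_sub_cancel, norm_one] at h2
  linarith

theorem norm_LFunction_le_two (χ : DirichletCharacter ℂ q) {s : ℂ} (hs : 2 ≤ s.re) :
    ‖χ.LFunction s‖ ≤ 2 := by
  have h1 := norm_LFunction_sub_one_le χ hs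
  have h2 := norm_add_le (χ.LFunction s - 1) 1
  rw [sub_add_cancel, norm_one] at h2
  linarith

theorem exists_LFunction_bounds (hχ : χ ≠ 1) (hG : GRH χ) {η : ℝ} (hη : 0 < η) (hη1 : η ≤ 1 / 2) :
    ∃ D : ℝ, 0 ≤ D ∧ ∀ s : ℂ, 1 / 2 + η ≤ s.re →
      1 / 3 * Real.exp (-(D * (1 + ‖s‖) ^ (1 / 2 : ℝ))) ≤ ‖χ.LFunction s‖ ∧
      ‖logDeriv χ.LFunction s‖ ≤ D * (1 + ‖s‖) ^ (1 / 2 : ℝ) := by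
  have hq : (0 : ℝ) < q := by have := NeZero.pos q; positivity
  set Q : ℝ := 2 * (36 * (q + 1)) ^ (1 / 2 : ℝ) with hQ
  have hQ0 : 0 ≤ Q := by positivity
  refine ⟨12 * Q / η ^ 2, by positivity, fun s hs => ?_⟩
  set c : ℂ := max s.re 2 + s.im * I with hc
  have hcre : c.re = max s.re 2 := by simp [hc]
  have hsc : s - c = ((s.re - max s.re 2 : ℝ) : ℂ) := by
    apply Complex.ext <;> simp [hc]
  have hz : ‖s - c‖ ≤ 3 / 2 - η := by
    rw [hsc, Complex.norm_real, Real.norm_eq_abs, abs_sub_comm, abs_of_nonneg (by simp)]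
    rcases max_cases s.re 2 with h | h <;> linarith
  have hc2 : 2 ≤ c.re := by rw [hcre]; exact le_max_right _ _
  have hcn : ‖c‖ ≤ ‖s‖ + 3 / 2 := by
    have := norm_sub_le s (s - c)
    rw [sub_sub_cancel] at this
    linarith
  have h3 := one_third_le_norm_LFunction χ hc2
  set B : ℝ := 12 * (q + 1) * (‖s‖ + 3) with hBdef
  have hB1 : 1 < B := by nlinarith [norm_nonneg s]
  have hball : ∀ z ∈ Metric.ball c (3 / 2), 1 / 2 < z.re := by
    intro z hz
    have h1 := mem_ball_iff_norm.1 hz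
    have h2 := Complex.abs_re_le_norm (z - c)
    have h3 := neg_abs_le (z - c).re
    rw [Complex.sub_re] at h2 h3
    linarith
  obtain ⟨b1, b2⟩ := norm_and_logDeriv_bounds (f := χ.LFunction) (c := c) (z := s) (R := 3 / 2) (B := B)
    (r := 3 / 2 - η) (ρ := η / 2) (by linarith) (by linarith) (by linarith) hB1
    (DirichletCharacter.differentiable_LFunction hχ).differentiableOn
    (fun z hz => LFunction_ne_zero_of_half_lt_re hχ hG (hball z hz))
    (fun z hz => by
      have h1 := norm_LFunction_le hχ (s := z) (by linarith [hball z hz])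
      have h2 : ‖z‖ ≤ ‖s‖ + 3 := by
        have := mem_ball_iff_norm.1 hz
        have := norm_sub_norm_le z c
        linarith
      have h4 : 4 * (q + 1) * ‖z‖ ≤ 4 * (q + 1) * (‖s‖ + 3) := by gcongr
      have h5 : B * (1 / 3) ≤ B * ‖χ.LFunction c‖ := by gcongr
      rw [hBdef] at h5 ⊢
      linarith) hz
  have hlog : Real.log B ≤ Q * (1 + ‖s‖) ^ (1 / 2 : ℝ) := by
    have h1 := Real.log_le_rpow_div (x := B) (by linarith) (ε := 1 / 2) (by norm_num)
    have h2 : B ≤ 36 * (q + 1) * (1 + ‖s‖) := by nlinarith [norm_nonneg s, mul_nonneg hq.le (norm_nonneg s)]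
    have h3 : B ^ (1 / 2 : ℝ) ≤ (36 * (q + 1) * (1 + ‖s‖)) ^ (1 / 2 : ℝ) :=
      Real.rpow_le_rpow (by linarith) h2 (by norm_num)
    rw [Real.mul_rpow (x := 36 * ((q : ℝ) + 1)) (by positivity) (by positivity)] at h3
    rw [hQ]
    linarith
  have hlog0 : 0 < Real.log B := Real.log_pos hB1
  set P := (1 + ‖s‖) ^ (1 / 2 : ℝ)
  have hP : 0 ≤ P := by positivity
  constructor
  · refine le_trans (mul_le_mul h3 (Real.exp_le_exp.2 (neg_le_neg ?_)) (Real.exp_pos _).le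
      (norm_nonneg _)) b1
    rw [show (3 / 2 - (3 / 2 - η) : ℝ) = η by ring]
    rw [div_le_iff₀ hη]
    have : 12 * Q / η ^ 2 * P * η = 12 * (Q * P) / η := by field_simp
    rw [this, le_div_iff₀ hη]
    nlinarith [mul_nonneg hQ0 hP, mul_nonneg hlog0.le hη.le, mul_nonneg (mul_nonneg hlog0.le hη.le) hη.le]
  · refine b2.trans ?_
    rw [show (3 / 2 - (3 / 2 - η + η / 2) : ℝ) = η / 2 by ring]
    rw [div_le_iff₀ (by linarith), div_le_iff₀ (by linarith)]
    have : 12 * Q / η ^ 2 * P * (η / 2) * (η / 2) = 3 * (Q * P) := by field_simp; ring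
    rw [this]
    nlinarith [mul_nonneg hlog0.le hη.le]

end

section

variable {q : ℕ} [NeZero q] {χ : DirichletCharacter ℂ q}

/-- The quotient of shifted L-functions to which the Phragmén–Lindelöf principle is applied. -/
noncomputable def shiftQuot (χ : DirichletCharacter ℂ q) (δ : ℝ) (z : ℂ) : ℂ :=
  χ.LFunction (1 / 2 + z - δ) / (χ.LFunction (1 / 2 + z + δ) * (z + 2) ^ (δ : ℂ))

lemma diffContOnCl_shiftQuot (hχ : χ ≠ 1) (hG : GRH χ) {δ : ℝ} (hδ : 0 < δ) :
    DiffContOnCl ℂ (shiftQuot χ δ) {z | 0 < z.re} := by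
  refine DifferentiableOn.diffContOnCl fun z hz => ?_
  rw [Complex.closure_setOfPred_lt_re] at hz
  have hz' : 0 ≤ z.re := hz
  have hL := DirichletCharacter.differentiable_LFunction hχ
  refine DifferentiableAt.differentiableWithinAt ?_
  have h2 : z + 2 ∈ slitPlane := Or.inl (by simp; linarith)
  refine DifferentiableAt.div ?_ (DifferentiableAt.mul ?_ ?_) (mul_ne_zero ?_ ?_)
  · exact hL.differentiableAt.comp z (by fun_prop)
  · exact hL.differentiableAt.comp z (by fun_prop)
  · exact (differentiableAt_id.add_const (2 : ℂ)).cpow_const h2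
  · exact LFunction_ne_zero_of_half_lt_re hχ hG (by simp; linarith)
  · simp [Complex.cpow_eq_zero_iff, slitPlane_ne_zero h2]

lemma norm_shiftQuot (δ : ℝ) (z : ℂ) : ‖shiftQuot χ δ z‖ =
    ‖χ.LFunction (1 / 2 + z - δ)‖ / (‖χ.LFunction (1 / 2 + z + δ)‖ * ‖z + 2‖ ^ δ) := by
  rw [shiftQuot, norm_div, norm_mul, Complex.norm_cpow_real]

lemma one_le_norm_add_two_rpow {z : ℂ} (hz : 0 ≤ z.re) {δ : ℝ} (hδ : 0 ≤ δ) :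
    1 ≤ ‖z + 2‖ ^ δ :=
  Real.one_le_rpow (by linarith [two_le_norm_add_two hz]) hδ

lemma isBigO_shiftQuot (hχ : χ ≠ 1) (hG : GRH χ) {δ : ℝ} (hδ : 0 < δ) (hδ1 : δ ≤ 1 / 4) :
    ∃ c < (2 : ℝ), ∃ B : ℝ, shiftQuot χ δ =O[Bornology.cobounded ℂ ⊓ 𝓟 {z | 0 < z.re}]
      fun z => Real.exp (B * ‖z‖ ^ c) := by
  obtain ⟨D, hD, hb⟩ := exists_LFunction_bounds hχ hG hδ (by linarith)
  refine ⟨1, by norm_num, 1 + D,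
    Asymptotics.IsBigO.of_bound (12 * (q + 1) * Real.exp (2 * D)) ?_⟩
  refine eventually_inf_principal.2 (Eventually.of_forall fun z hz => ?_)
  have hz' : 0 < z.re := hz
  rw [norm_shiftQuot, Real.rpow_one, Real.norm_of_nonneg (Real.exp_pos _).le]
  have h1 := norm_LFunction_le hχ (s := 1 / 2 + z - δ) (by simp; linarith)
  have h2 := (hb (1 / 2 + z + δ) (by simp; linarith)).1
  have h3 := one_le_norm_add_two_rpow hz'.le hδ.le
  have hhalf : ‖(1 / 2 : ℂ)‖ = 1 / 2 := by simp
  have hδn : ‖(δ : ℂ)‖ ≤ 1 / 4 := by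
    rw [Complex.norm_real, Real.norm_of_nonneg hδ.le]; exact hδ1
  have h4 : ‖1 / 2 + z - δ‖ ≤ 1 + ‖z‖ := by
    have := norm_sub_le (1 / 2 + z) (δ : ℂ)
    have := norm_add_le (1 / 2 : ℂ) z
    linarith
  have h5 : ‖1 / 2 + z + δ‖ ≤ 1 + ‖z‖ := by
    have := norm_add_le (1 / 2 + z) (δ : ℂ)
    have := norm_add_le (1 / 2 : ℂ) z
    linarith
  have h6 : (1 + ‖1 / 2 + z + δ‖) ^ (1 / 2 : ℝ) ≤ 2 + ‖z‖ := by
    have h7 : (1 : ℝ) ≤ 1 + ‖1 / 2 + z + δ‖ := by linarith [norm_nonneg (1 / 2 + z + δ)]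
    have := Real.rpow_le_rpow_of_exponent_le h7 (by norm_num : (1 / 2 : ℝ) ≤ 1)
    rw [Real.rpow_one] at this
    linarith
  have h8 : 1 / 3 * Real.exp (-(D * (2 + ‖z‖))) ≤
      ‖χ.LFunction (1 / 2 + z + δ)‖ * ‖z + 2‖ ^ δ := by
    refine le_trans (le_trans ?_ h2) (le_mul_of_one_le_right (norm_nonneg _) h3)
    gcongr
  have h9 : ‖χ.LFunction (1 / 2 + z - δ)‖ ≤ 4 * (q + 1) * Real.exp ‖z‖ := by
    refine h1.trans ?_
    have := Real.add_one_le_exp ‖z‖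
    gcongr
    linarith
  calc _ ≤ 4 * (q + 1) * Real.exp ‖z‖ / (1 / 3 * Real.exp (-(D * (2 + ‖z‖)))) := by gcongr
    _ = _ := by
      rw [Real.exp_neg, show (1 + D) * ‖z‖ = ‖z‖ + D * ‖z‖ by ring,
        show D * (2 + ‖z‖) = 2 * D + D * ‖z‖ by ring, Real.exp_add, Real.exp_add]
      field_simp
      norm_num

lemma isBoundedUnder_shiftQuot {δ : ℝ} (hδ : 0 ≤ δ) :
    IsBoundedUnder (· ≤ ·) atTop fun x : ℝ => ‖shiftQuot χ δ x‖ := by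
  refine isBoundedUnder_of_eventually_le (a := 6) ?_
  filter_upwards [eventually_ge_atTop (2 + δ)] with x hx
  rw [norm_shiftQuot]
  have h1 := norm_LFunction_le_two χ (s := 1 / 2 + x - δ) (by simp; linarith)
  have h2 := one_third_le_norm_LFunction χ (s := 1 / 2 + x + δ) (by simp; linarith)
  have h3 := one_le_norm_add_two_rpow (z := (x : ℂ)) (by simp; linarith) hδ
  rw [div_le_iff₀ (by nlinarith)]
  nlinarith

end

theorem exists_norm_LFunction_sub_le_of_re_nonneg : ∃ K : ℝ, 0 ≤ K ∧ ∀ (q : ℕ) [NeZero q]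
    (χ : DirichletCharacter ℂ q), 1 < q → χ.IsPrimitive → GRH χ → ∀ δ : ℝ, 0 < δ → δ ≤ 1 / 4 →
    ∀ z : ℂ, 0 ≤ z.re → ‖χ.LFunction (1 / 2 + z - δ)‖ ≤
      (q * Real.exp K * ‖z + 2‖) ^ δ * ‖χ.LFunction (1 / 2 + z + δ)‖ := by
  obtain ⟨K, hK, h⟩ := exists_norm_LFunction_sub_le
  refine ⟨K, hK, fun q _ χ hq hχ hG δ h0 h1 z hz => ?_⟩
  have hχ1 := ne_one_of_isPrimitive hq hχ
  have hq0 : (0 : ℝ) < q := by positivity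
  have hden : ∀ z : ℂ, 0 ≤ z.re → 0 < ‖χ.LFunction (1 / 2 + z + δ)‖ * ‖z + 2‖ ^ δ := fun z hz =>
    mul_pos (norm_pos_iff.2 (LFunction_ne_zero_of_half_lt_re hχ1 hG (by simp; linarith)))
      (zero_lt_one.trans_le (one_le_norm_add_two_rpow hz h0.le))
  have key := PhragmenLindelof.right_half_plane_of_bounded_on_real
    (C := (q * Real.exp K) ^ δ) (diffContOnCl_shiftQuot hχ1 hG h0) (isBigO_shiftQuot hχ1 hG h0 h1)
    (isBoundedUnder_shiftQuot h0.le) (fun t => ?_) hz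
  · rw [norm_shiftQuot, div_le_iff₀ (hden z hz)] at key
    refine key.trans_eq ?_
    rw [Real.mul_rpow (x := q * Real.exp K) (by positivity) (norm_nonneg _)]
    ring
  · rw [norm_shiftQuot, div_le_iff₀ (hden _ (by simp))]
    have h2 := h q χ hq hχ hG δ t h0.le h1
    rw [show (1 / 2 + t * I - δ : ℂ) = 1 / 2 - δ + t * I by ring,
      show (1 / 2 + t * I + δ : ℂ) = 1 / 2 + δ + t * I by ring]
    refine h2.trans_eq ?_
    rw [Real.mul_rpow (x := q * Real.exp K) (by positivity) (norm_nonneg _)]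
    ring

lemma nonneg_of_hasDerivAt_of_nonneg {φ : ℝ → ℝ} {d ε : ℝ} (hε : 0 < ε) (h : HasDerivAt φ d 0)
    (h0 : φ 0 = 0) (hφ : ∀ x, 0 < x → x < ε → 0 ≤ φ x) : 0 ≤ d := by
  have h1 := (hasDerivAt_iff_tendsto_slope.1 h).mono_left
    (nhdsWithin_mono 0 (fun x (hx : x ∈ Ioi (0 : ℝ)) => ne_of_gt hx))
  refine ge_of_tendsto h1 ?_
  filter_upwards [Ioo_mem_nhdsGT hε] with x hx
  rw [slope_def_field, h0, sub_zero, sub_zero]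
  exact div_nonneg (hφ x hx.1 hx.2) hx.1.le

theorem exists_re_logDeriv_LFunction_ge : ∃ K : ℝ, 0 ≤ K ∧ ∀ (q : ℕ) [NeZero q]
    (χ : DirichletCharacter ℂ q), 1 < q → χ.IsPrimitive → GRH χ → ∀ s : ℂ, 1 / 2 < s.re →
    -(1 / 2 * (Real.log (q * ‖s + 3 / 2‖) + K)) ≤ (logDeriv χ.LFunction s).re := by
  obtain ⟨K, hK, h⟩ := exists_norm_LFunction_sub_le_of_re_nonneg
  refine ⟨K, hK, fun q _ χ hq hχ hG s hs => ?_⟩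
  have hχ1 := ne_one_of_isPrimitive hq hχ
  have hq0 : (0 : ℝ) < q := by positivity
  have hR : 0 < s.re - 1 / 2 := by linarith
  have hball : ∀ z ∈ Metric.ball s (s.re - 1 / 2), χ.LFunction z ≠ 0 := by
    intro z hz
    refine LFunction_ne_zero_of_half_lt_re hχ1 hG ?_
    have h1 := mem_ball_iff_norm.1 hz
    have h2 := Complex.abs_re_le_norm (z - s)
    have h3 := neg_abs_le (z - s).re
    rw [Complex.sub_re] at h2 h3
    linarith
  obtain ⟨ℓ, hℓ0, hℓ, hexp⟩ := exists_log_on_ball hR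
    (DirichletCharacter.differentiable_LFunction hχ1).differentiableOn hball
  have hs0 := norm_pos_iff.2 (hball s (Metric.mem_ball_self hR))
  set c : ℝ := Real.log (q * Real.exp K * ‖s + 3 / 2‖) with hc
  have hs3 : 0 < ‖s + 3 / 2‖ := by
    refine norm_pos_iff.2 fun h => ?_
    have := congrArg Complex.re h
    norm_num at this
    linarith
  have hc' : c = Real.log (q * ‖s + 3 / 2‖) + K := by
    rw [hc, mul_right_comm, Real.log_mul (by positivity) (by positivity), Real.log_exp]
  have hℓs := hℓ s (Metric.mem_ball_self hR)
  have hder : HasDerivAt (fun x : ℝ => (ℓ (s + x) - ℓ (s - x) + c * x).re)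
      (logDeriv χ.LFunction s + logDeriv χ.LFunction s + c).re 0 := by
    refine HasDerivAt.real_of_complex (e := fun w => ℓ (s + w) - ℓ (s - w) + c * w) ?_
    have h1 : HasDerivAt (fun w => ℓ (s + w)) (logDeriv χ.LFunction s) ((0 : ℝ) : ℂ) := by
      refine HasDerivAt.comp_const_add s _ ?_
      simpa using hℓs
    have h2 : HasDerivAt (fun w => ℓ (s - w)) (-logDeriv χ.LFunction s) ((0 : ℝ) : ℂ) := by
      refine HasDerivAt.comp_const_sub s _ ?_
      simpa using hℓs
    have h3 : HasDerivAt (fun w : ℂ => c * w) (c : ℂ) ((0 : ℝ) : ℂ) := by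
      simpa using (hasDerivAt_id (((0 : ℝ) : ℂ))).const_mul (c : ℂ)
    convert! (h1.sub h2).add h3 using 1
    ring
  have := nonneg_of_hasDerivAt_of_nonneg (ε := min (1 / 4) (s.re - 1 / 2)) (lt_min (by norm_num) hR)
    hder (by simp) fun x hx0 hx => ?_
  · simp only [Complex.add_re, Complex.ofReal_re] at this
    rw [hc'] at this
    linarith
  · have hx1 := (lt_min_iff.1 hx).1
    have hx2 := (lt_min_iff.1 hx).2
    have hm1 : s + x ∈ Metric.ball s (s.re - 1 / 2) := by
      rw [mem_ball_iff_norm, add_sub_cancel_left, Complex.norm_real, Real.norm_of_nonneg hx0.le]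
      exact hx2
    have hm2 : s - x ∈ Metric.ball s (s.re - 1 / 2) := by
      rw [mem_ball_iff_norm, sub_sub_cancel_left, norm_neg, Complex.norm_real,
        Real.norm_of_nonneg hx0.le]
      exact hx2
    have h4 := h q χ hq hχ hG x hx0 hx1.le (s - 1 / 2) (by simp; linarith)
    rw [add_sub_cancel, hexp _ hm1, hexp _ hm2, norm_mul, norm_mul, Complex.norm_exp,
      Complex.norm_exp, show s - 1 / 2 + 2 = s + 3 / 2 by ring,
      Real.rpow_def_of_pos (by positivity), ← hc, mul_left_comm, ← Real.exp_add] at h4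
    have h5 := Real.exp_le_exp.1 (le_of_mul_le_mul_left h4 hs0)
    simp only [Complex.add_re, Complex.sub_re, Complex.mul_re, Complex.ofReal_re,
      Complex.ofReal_im, mul_zero, sub_zero]
    linarith

lemma re_neg_log_mul (n : ℕ) (w : ℂ) : (-(Real.log n * w)).re = -(Real.log n * w.re) := by
  rw [Complex.neg_re, Complex.re_ofReal_mul]

section Series

variable {q : ℕ} {χ : DirichletCharacter ℂ q} {s₀ : ℂ}

/-- The coefficients of `L'/L` at `s₀`, written with exponentials. -/
noncomputable def logDerivCoeff (χ : DirichletCharacter ℂ q) (s₀ : ℂ) (n : ℕ) : ℂ :=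
  -(χ n * (ArithmeticFunction.vonMangoldt n : ℂ) * cexp (-(Real.log n * s₀)))

lemma norm_logDerivCoeff_le (χ : DirichletCharacter ℂ q) (n : ℕ) :
    ‖logDerivCoeff χ s₀ n‖ ≤
      ArithmeticFunction.vonMangoldt n * Real.exp (-(Real.log n * s₀.re)) := by
  rw [logDerivCoeff, norm_neg, norm_mul, norm_mul, Complex.norm_exp, Complex.norm_real,
    Real.norm_of_nonneg ArithmeticFunction.vonMangoldt_nonneg]
  have := χ.norm_le_one (n : ZMod q)
  rw [re_neg_log_mul]
  refine mul_le_mul_of_nonneg_right ?_ (Real.exp_pos _).le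
  exact mul_le_of_le_one_left ArithmeticFunction.vonMangoldt_nonneg this

variable [NeZero q]

lemma tameOn_logDeriv_LFunction (hχ : χ ≠ 1) (hG : GRH χ) (hs : 1 / 2 < s₀.re) :
    TameOn fun z => logDeriv χ.LFunction (s₀ + z) := by
  have hL := DirichletCharacter.differentiable_LFunction hχ
  constructor
  · intro z hz
    have h0 := LFunction_ne_zero_of_half_lt_re hχ hG (s := s₀ + z) (by simp; linarith)
    have h1 : DifferentiableAt ℂ (logDeriv χ.LFunction) (s₀ + z) :=
      DifferentiableAt.div (hL.analyticAt (s₀ + z)).deriv.differentiableAt hL.differentiableAt h0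
    exact h1.comp z (differentiableAt_id.const_add s₀)
  · obtain ⟨D, hD, hb⟩ := exists_LFunction_bounds hχ hG (η := min (1 / 2) (s₀.re - 1 / 2))
      (lt_min (by norm_num) (by linarith)) (min_le_left _ _)
    refine ⟨D * (1 + ‖s₀‖) ^ (1 / 2 : ℝ), fun z hz => ?_⟩
    have h1 := (hb (s₀ + z) (by
      have := min_le_right (1 / 2 : ℝ) (s₀.re - 1 / 2)
      simp only [Complex.add_re]; linarith)).2
    refine h1.trans ?_
    rw [mul_assoc, ← Real.mul_rpow (by positivity) (by positivity)]
    gcongr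
    have := norm_add_le s₀ z
    nlinarith [norm_nonneg s₀, norm_nonneg z, mul_nonneg (norm_nonneg s₀) (norm_nonneg z)]

lemma hasSum_logDerivCoeff (χ : DirichletCharacter ℂ q) {v : ℂ} (hv : 1 < (s₀ + v).re) :
    HasSum (fun n : ℕ => logDerivCoeff χ s₀ n * cexp (-(Real.log n * v)))
      (logDeriv χ.LFunction (s₀ + v)) := by
  have h1 := (DirichletCharacter.LSeriesSummable_twist_vonMangoldt χ hv).hasSum.neg
  have h2 := DirichletCharacter.LSeries_twist_vonMangoldt_eq χ hv
  rw [LSeries] at h2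
  rw [h2, neg_div, neg_neg, ← DirichletCharacter.deriv_LFunction_eq_deriv_LSeries χ hv,
    ← DirichletCharacter.LFunction_eq_LSeries χ hv] at h1
  rw [logDeriv_apply]
  refine h1.congr_fun fun n => ?_
  rcases eq_or_ne n 0 with rfl | hn
  · simp [logDerivCoeff]
  · rw [LSeries.term_of_ne_zero hn, Complex.cpow_def_of_ne_zero (by exact_mod_cast hn),
      div_eq_mul_inv, ← Complex.exp_neg, logDerivCoeff, neg_mul, mul_assoc _ (cexp _),
      ← Complex.exp_add, Complex.natCast_log]
    simp only [Pi.mul_apply]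
    ring_nf

lemma summable_norm_logDerivCoeff (χ : DirichletCharacter ℂ q) (hs : 1 / 2 < s₀.re) :
    Summable fun n : ℕ => ‖logDerivCoeff χ s₀ n‖ * Real.exp (-2 * Real.log n) := by
  refine (hasSum_logDerivCoeff χ (s₀ := s₀) (v := 2) (by simp; linarith)).summable.norm.congr
    fun n => ?_
  rw [norm_mul, Complex.norm_exp]
  rw [re_neg_log_mul, Complex.re_ofNat, mul_comm (Real.log _), neg_mul]

end Series

lemma sum_inv_sqrt_le (m : ℕ) : ∑ n ∈ Finset.range (m + 1), 1 / √(n : ℝ) ≤ 2 * √m := by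
  induction m with
  | zero => simp
  | succ m ih =>
    rw [Finset.sum_range_succ]
    have h1 : 0 < √((m + 1 : ℕ) : ℝ) := Real.sqrt_pos.2 (by positivity)
    have h2 := Real.sqrt_nonneg (m : ℝ)
    have h3 : √(m : ℝ) ^ 2 = m := Real.sq_sqrt (by positivity)
    have h4 : √((m + 1 : ℕ) : ℝ) ^ 2 = m + 1 := by rw [Real.sq_sqrt (by positivity)]; push_cast; ring
    have h5 : 1 / √((m + 1 : ℕ) : ℝ) ≤ 2 * √((m + 1 : ℕ) : ℝ) - 2 * √m := by
      rw [div_le_iff₀ h1]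
      nlinarith [sq_nonneg (√((m + 1 : ℕ) : ℝ) - √m)]
    linarith

lemma exp_neg_log_mul_half_le (n : ℕ) (hn : n ≠ 0) :
    Real.exp (-(Real.log n * (1 / 2))) = 1 / √(n : ℝ) := by
  have : (0 : ℝ) < n := by positivity
  rw [Real.exp_neg, ← one_div, Real.sqrt_eq_rpow, Real.rpow_def_of_pos this]

lemma sum_vonMangoldt_le {u : ℝ} (hu : 0 ≤ u) :
    ∑ n ∈ Finset.range ⌈Real.exp u⌉₊,
      ArithmeticFunction.vonMangoldt n * Real.exp (-(Real.log n * (1 / 2))) ≤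
      2 * u * Real.exp (u / 2) := by
  have hN : 0 < ⌈Real.exp u⌉₊ := Nat.ceil_pos.2 (Real.exp_pos u)
  obtain ⟨m, hm⟩ := Nat.exists_eq_succ_of_ne_zero hN.ne'
  have hlt : (m : ℝ) < Real.exp u := Nat.lt_ceil.1 (by omega)
  calc _ ≤ ∑ n ∈ Finset.range (m + 1), u * (1 / √(n : ℝ)) := by
        rw [hm]
        refine Finset.sum_le_sum fun n hn => ?_
        rcases eq_or_ne n 0 with rfl | h0
        · simp
        · rw [exp_neg_log_mul_half_le n h0]
          refine mul_le_mul_of_nonneg_right ?_ (by positivity)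
          refine ArithmeticFunction.vonMangoldt_le_log.trans ?_
          have h1 : (n : ℝ) ≤ m := by exact_mod_cast Nat.lt_succ_iff.1 (Finset.mem_range.1 hn)
          rw [Real.log_le_iff_le_exp (by positivity)]
          linarith
    _ ≤ u * (2 * √m) := by
        rw [← Finset.mul_sum]
        exact mul_le_mul_of_nonneg_left (sum_inv_sqrt_le m) hu
    _ ≤ u * (2 * Real.exp (u / 2)) := by
        have : √(m : ℝ) ≤ Real.exp (u / 2) := by
          rw [Real.sqrt_le_left (Real.exp_pos _).le, ← Real.exp_nat_mul]
          rw [Nat.cast_ofNat, mul_div_cancel₀ u two_ne_zero]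
          exact hlt.le
        gcongr
    _ = _ := by ring

lemma summable_vonMangoldt : Summable fun n : ℕ =>
    ArithmeticFunction.vonMangoldt n * Real.exp (-(Real.log n * (3 / 2))) := by
  have h : Summable fun n : ℕ => 4 * (n : ℝ) ^ (-(5 / 4) : ℝ) :=
    (Real.summable_nat_rpow.2 (by norm_num)).mul_left 4
  refine Summable.of_nonneg_of_le (fun n => mul_nonneg ArithmeticFunction.vonMangoldt_nonneg
    (Real.exp_pos _).le) (fun n => ?_) h
  rcases eq_or_ne n 0 with rfl | h0
  · simp
  · have hn : (0 : ℝ) < n := by positivity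
    have h1 := (ArithmeticFunction.vonMangoldt_le_log (n := n)).trans
      (Real.log_le_rpow_div hn.le (ε := 1 / 4) (by norm_num))
    have h2 : Real.exp (-(Real.log n * (3 / 2))) = (n : ℝ) ^ (-(3 / 2) : ℝ) := by
      rw [Real.rpow_def_of_pos hn]; ring_nf
    rw [h2]
    calc _ ≤ (n : ℝ) ^ (1 / 4 : ℝ) / (1 / 4) * (n : ℝ) ^ (-(3 / 2) : ℝ) := by gcongr
      _ = 4 * ((n : ℝ) ^ (1 / 4 : ℝ) * (n : ℝ) ^ (-(3 / 2) : ℝ)) := by ring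
      _ = _ := by rw [← Real.rpow_add hn]; norm_num

lemma half_le_log_two : 1 / 2 ≤ Real.log 2 := by linarith [Real.log_two_gt_d9]

lemma norm_logDeriv_LFunction_le {q : ℕ} [NeZero q] (χ : DirichletCharacter ℂ q) {s₀ : ℂ}
    (hs : 1 / 2 < s₀.re) {b : ℝ} (hb : 1 ≤ b) : ‖logDeriv χ.LFunction (s₀ + b)‖ ≤
      (Real.exp (1 / 2) * ∑' n : ℕ, ArithmeticFunction.vonMangoldt n *
        Real.exp (-(Real.log n * (3 / 2)))) * Real.exp (-(1 / 2) * b) := by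
  have h1 := hasSum_logDerivCoeff χ (s₀ := s₀) (v := b) (by simp; linarith)
  rw [← h1.tsum_eq, mul_right_comm, ← Real.exp_add]
  refine tsum_of_norm_bounded (summable_vonMangoldt.hasSum.mul_left _) fun n => ?_
  rw [norm_mul, Complex.norm_exp, re_neg_log_mul, Complex.ofReal_re]
  rcases lt_or_ge n 2 with hn | hn
  · have : ArithmeticFunction.vonMangoldt n = 0 := by interval_cases n <;> simp
    have h2 := norm_logDerivCoeff_le χ n (s₀ := s₀)
    rw [this, zero_mul] at h2
    rw [norm_le_zero_iff.1 h2, this]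
    simp
  · have hlog : 1 / 2 ≤ Real.log n := half_le_log_two.trans
      (Real.log_le_log two_pos (by exact_mod_cast hn))
    calc _ ≤ ArithmeticFunction.vonMangoldt n * Real.exp (-(Real.log n * s₀.re)) *
          Real.exp (-(Real.log n * b)) :=
          mul_le_mul_of_nonneg_right (norm_logDerivCoeff_le χ n) (Real.exp_pos _).le
      _ = ArithmeticFunction.vonMangoldt n * Real.exp (-(Real.log n * (s₀.re + b))) := by
          rw [mul_assoc, ← Real.exp_add]; ring_nf
      _ ≤ ArithmeticFunction.vonMangoldt n *
          Real.exp ((1 / 2 + -(1 / 2) * b) + -(Real.log n * (3 / 2))) := by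
          refine mul_le_mul_of_nonneg_left (Real.exp_le_exp.2 ?_)
            ArithmeticFunction.vonMangoldt_nonneg
          nlinarith
      _ = _ := by rw [Real.exp_add]; ring

lemma setIntegral_Ioi_add_right (f : ℝ → ℝ) (c : ℝ) :
    ∫ b in Ioi (0 : ℝ), f (b + c) = ∫ x in Ioi c, f x := by
  have h := (measurePreserving_add_right (volume : Measure ℝ) c).setIntegral_preimage_emb
    (MeasurableEquiv.addRight c).measurableEmbedding f (Ioi c)
  rw [← h]
  congr 2
  ext x
  simp

/-- A bound valid on every half line to the right of `1/2` passes to the limit. -/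
lemma abs_integral_Ioi_half_le {f : ℝ → ℝ} {B : ℝ} (hB : 0 ≤ B)
    (h : ∀ η : ℝ, 0 < η → η ≤ 1 / 2 → |∫ x in Ioi (1 / 2 + η), f x| ≤ B) :
    |∫ x in Ioi (1 / 2 : ℝ), f x| ≤ B := by
  by_cases hf : IntegrableOn f (Ioi (1 / 2 : ℝ))
  · have hU : ⋃ n : ℕ, Ioi (1 / 2 + 1 / ((n : ℝ) + 2)) = Ioi (1 / 2 : ℝ) := by
      ext x
      simp only [mem_iUnion, mem_Ioi]
      constructor
      · rintro ⟨n, hn⟩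
        have : 0 < 1 / ((n : ℝ) + 2) := by positivity
        linarith
      · intro hx
        obtain ⟨n, hn⟩ := exists_nat_gt (1 / (x - 1 / 2))
        refine ⟨n, ?_⟩
        have hx' : 0 < x - 1 / 2 := by linarith
        rw [div_lt_iff₀ hx'] at hn
        have : 1 / ((n : ℝ) + 2) < x - 1 / 2 := by
          rw [div_lt_iff₀ (by positivity)]
          nlinarith
        linarith
    have hlim := tendsto_setIntegral_of_monotone (f := f) (μ := volume)
      (s := fun n : ℕ => Ioi (1 / 2 + 1 / ((n : ℝ) + 2))) (fun _ => measurableSet_Ioi)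
      (fun m n hmn => Ioi_subset_Ioi (by gcongr)) (by rwa [hU])
    rw [hU] at hlim
    refine le_of_tendsto hlim.abs (Eventually.of_forall fun n => h _ (by positivity) ?_)
    rw [div_le_div_iff₀ (by positivity) (by norm_num)]
    linarith [(n.cast_nonneg : (0 : ℝ) ≤ n)]
  · rw [integral_undef hf, abs_zero]
    exact hB

lemma log_mul_norm_le {q t η y : ℝ} (hq : 1 ≤ q) (ht : 2 ≤ t) (hη : 0 < η) (hη' : η ≤ 1 / 2) :
    Real.log (q * ‖(1 / 2 + η + t * I + y * I + 3 / 2 : ℂ)‖) ≤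
      Real.log (q * (t + 3)) + Real.log ‖(y * I + 2 : ℂ)‖ := by
  have h2 : 2 ≤ ‖(y * I + 2 : ℂ)‖ := by
    have := Complex.re_le_norm (y * I + 2 : ℂ)
    simpa using this
  have h3 : ‖(1 / 2 + η + t * I + y * I + 3 / 2 : ℂ)‖ ≤ (t + 3) * ‖(y * I + 2 : ℂ)‖ := by
    have : (1 / 2 + η + t * I + y * I + 3 / 2 : ℂ) = (y * I + 2) + (η + t * I) := by ring
    rw [this]
    refine (norm_add_le _ _).trans ?_
    have h4 : ‖(η + t * I : ℂ)‖ ≤ η + t := by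
      refine (norm_add_le _ _).trans ?_
      rw [norm_mul, Complex.norm_I, Complex.norm_real, Complex.norm_real, mul_one,
        Real.norm_of_nonneg hη.le, Real.norm_of_nonneg (by linarith)]
    nlinarith
  have h0 : 0 < ‖(1 / 2 + η + t * I + y * I + 3 / 2 : ℂ)‖ := by
    refine lt_of_lt_of_le ?_ (Complex.re_le_norm _)
    simp
    linarith
  rw [← Real.log_mul (by positivity) (by positivity), mul_assoc]
  gcongr

lemma exists_abs_argS_le : ∃ K : ℝ, 0 ≤ K ∧ ∀ (q : ℕ) [NeZero q] (χ : DirichletCharacter ℂ q),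
    1 < q → χ.IsPrimitive → GRH χ → ∀ t : ℝ, 2 ≤ t → ∀ u : ℝ, 3 ≤ u →
      π * |argS χ t| ≤
        6.1 * (1 / 2 * Real.log (q * (t + 3)) + K) / u + 40 * u * Real.exp (u / 2) + K := by
  obtain ⟨K, hK, hre⟩ := exists_re_logDeriv_LFunction_ge
  set K₂ := Real.exp (1 / 2) * ∑' n : ℕ, ArithmeticFunction.vonMangoldt n *
    Real.exp (-(Real.log n * (3 / 2))) with hK₂
  have hK₂0 : 0 ≤ K₂ := mul_nonneg (Real.exp_pos _).le (tsum_nonneg fun n =>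
    mul_nonneg ArithmeticFunction.vonMangoldt_nonneg (Real.exp_pos _).le)
  refine ⟨K / 2 + 2 * K₂ + 21, by positivity, fun q _ χ hq hχ hG t ht u hu => ?_⟩
  have hq1 : (1 : ℝ) ≤ q := by exact_mod_cast hq.le
  have hlog : 0 ≤ Real.log (q * (t + 3)) := Real.log_nonneg (by nlinarith)
  have hχ1 := ne_one_of_isPrimitive hq hχ
  rw [argS, abs_mul, abs_neg, abs_of_pos (by positivity), ← mul_assoc,
    mul_one_div_cancel Real.pi_ne_zero, one_mul]
  refine abs_integral_Ioi_half_le (by positivity) fun η hη hη' => ?_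
  set s₀ : ℂ := 1 / 2 + η + t * I with hs₀
  have hs₀re : s₀.re = 1 / 2 + η := by simp [hs₀]
  have hs : 1 / 2 < s₀.re := by rw [hs₀re]; linarith
  set M := 1 / 2 * (Real.log (q * (t + 3)) + K) with hM
  have key := (tameOn_logDeriv_LFunction hχ1 hG hs).abs_integral_im_le (M := M) (by positivity)
    (fun y => by
      refine le_trans ?_ (hre q χ hq hχ hG (s₀ + y * I) (by simpa using hs))
      have := log_mul_norm_le (y := y) hq1 ht hη hη'
      rw [hM]
      linarith) (summable_norm_logDerivCoeff χ hs)
    (fun v hv => hasSum_logDerivCoeff χ (by rw [Complex.add_re, hv]; linarith)) hu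
    (fun b hb => norm_logDeriv_LFunction_le χ hs hb)
  have hshift : ∫ b in Ioi (0 : ℝ), (logDeriv χ.LFunction (s₀ + b)).im =
      ∫ σ in Ioi (1 / 2 + η), (logDeriv χ.LFunction (σ + t * I)).im := by
    rw [← setIntegral_Ioi_add_right (fun σ => (logDeriv χ.LFunction (σ + t * I)).im)]
    congr 1
    funext b
    congr 2
    rw [hs₀]
    push_cast
    ring
  have hsum : ∑ n ∈ Finset.range ⌈Real.exp u⌉₊, ‖logDerivCoeff χ s₀ n‖ ≤
      2 * u * Real.exp (u / 2) := by
    refine le_trans (Finset.sum_le_sum fun n _ => ?_) (sum_vonMangoldt_le (by linarith))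
    refine (norm_logDerivCoeff_le χ n).trans ?_
    have := Real.log_natCast_nonneg n
    have := ArithmeticFunction.vonMangoldt_nonneg (n := n)
    gcongr
  rw [hshift, ← hK₂] at key
  refine key.trans ?_
  have h6 : 6.1 * (M + 1) / u ≤
      6.1 * (1 / 2 * Real.log (q * (t + 3)) + (K / 2 + 2 * K₂ + 21)) / u := by
    refine div_le_div_of_nonneg_right (mul_le_mul_of_nonneg_left ?_ (by norm_num)) (by linarith)
    rw [hM]
    linarith
  linarith

/-- The choice `u = 3 + 3/2 log X` balances the terms of `exists_abs_argS_le`. -/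
lemma exists_optimized_bound {K : ℝ} (hK : 0 ≤ K) : ∃ C : ℝ, 0 < C ∧ ∀ S X X₁ : ℝ, 2 ≤ X →
    X - 1 ≤ X₁ → 0 ≤ S →
    (∀ u : ℝ, 3 ≤ u → π * S ≤ 6.1 * (1 / 2 * X + K) / u + 40 * u * Real.exp (u / 2) + K) →
      S < 0.804 * (X₁ / Real.log X) + C * (X / Real.log X ^ 2) := by
  refine ⟨16 * K + 40 * Real.exp (3 / 2) * 672 + 2, by positivity, fun S X X₁ hX hX₁ hS h => ?_⟩
  have hX0 : 0 < X := by linarith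
  set Y := Real.log X with hY
  have hY0 : 0 < Y := Real.log_pos (by linarith)
  have hXY : X = Real.exp Y := (Real.exp_log hX0).symm
  have hYX : Y ≤ X := by linarith [Real.log_le_sub_one_of_pos hX0]
  set R := X / Y ^ 2 with hR
  have hR4 : 1 / 4 ≤ R := by
    rw [hR, div_le_div_iff₀ (by norm_num) (by positivity)]
    have := Real.quadratic_le_exp_of_nonneg hY0.le
    rw [← hXY] at this
    linarith
  have hYR : 1 / Y ≤ R := by
    rw [hR, div_le_div_iff₀ hY0 (by positivity)]
    nlinarith
  have hexp : (3 + 3 / 2 * Y) * Y ^ 2 ≤ 672 * Real.exp (Y / 4) := by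
    have h2 := Real.pow_div_factorial_le_exp (Y / 4) (by positivity) 2
    have h3 := Real.pow_div_factorial_le_exp (Y / 4) (by positivity) 3
    norm_num [Nat.factorial] at h2 h3
    nlinarith
  have hmain : (3 + 3 / 2 * Y) * Real.exp ((3 + 3 / 2 * Y) / 2) ≤
      Real.exp (3 / 2) * 672 * R := by
    have e1 : Real.exp ((3 + 3 / 2 * Y) / 2) =
        Real.exp (3 / 2) * Real.exp (3 / 4 * Y) := by
      rw [← Real.exp_add]
      ring_nf
    have e2 : X = Real.exp (Y / 4) * Real.exp (3 / 4 * Y) := by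
      rw [← Real.exp_add, hXY]
      ring_nf
    rw [e1, hR, ← mul_div_assoc, le_div_iff₀ (by positivity), e2]
    calc _ = (3 + 3 / 2 * Y) * Y ^ 2 * (Real.exp (3 / 2) * Real.exp (3 / 4 * Y)) := by ring
      _ ≤ 672 * Real.exp (Y / 4) * (Real.exp (3 / 2) * Real.exp (3 / 4 * Y)) := by gcongr
      _ = _ := by ring
  have h1 := h (3 + 3 / 2 * Y) (by linarith)
  have h4 : 6.1 * (1 / 2 * X + K) / (3 + 3 / 2 * Y) ≤ 2.04 * (X / Y) + 3 * K := by
    have h5 : 6.1 * (1 / 2 * X) / (3 + 3 / 2 * Y) ≤ 2.04 * (X / Y) := by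
      rw [← mul_div_assoc, div_le_div_iff₀ (by positivity) hY0]
      nlinarith [mul_pos hX0 hY0]
    have h6 : 6.1 * K / (3 + 3 / 2 * Y) ≤ 3 * K := by
      rw [div_le_iff₀ (by positivity)]
      nlinarith [mul_nonneg hK hY0.le]
    rw [mul_add, add_div]
    linarith
  have h7 : X / Y - 1 / Y ≤ X₁ / Y := by
    rw [← sub_div]
    gcongr
  have h8 : 3.14 * S ≤ π * S := by gcongr; exact Real.pi_gt_d2.le
  have h9 : 0 < X / Y := by positivity
  nlinarith [mul_nonneg hK (by linarith : 0 ≤ R - 1 / 4),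
    mul_nonneg (Real.exp_pos (3 / 2)).le (by linarith : 0 ≤ R)]

lemma two_le_log {q t : ℝ} (hq : 2 ≤ q) (ht : 2 ≤ t) : 2 ≤ Real.log (q * (t + 3)) := by
  rw [Real.le_log_iff_exp_le (by positivity)]
  have h := Real.exp_one_lt_d9
  have h2 : Real.exp 2 = Real.exp 1 ^ 2 := by rw [← Real.exp_nat_mul]; norm_num
  nlinarith [Real.exp_pos 1]

lemma log_mul_sub_one_le {q t : ℝ} (hq : 2 ≤ q) (ht : 2 ≤ t) :
    Real.log (q * (t + 3)) - 1 ≤ Real.log (q * (t + 1)) := by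
  have h : Real.log (q * (t + 3)) ≤ Real.log (q * (t + 1) * Real.exp 1) := by
    refine Real.log_le_log (by positivity) ?_
    rw [mul_assoc]
    gcongr
    nlinarith [Real.add_one_le_exp 1]
  rw [Real.log_mul (by positivity) (Real.exp_pos 1).ne', Real.log_exp] at h
  linarith

end

theorem explicit_bound_S :
    ∃ C : ℝ, 0 < C ∧
      ∀ (q : ℕ) [NeZero q] (χ : DirichletCharacter ℂ q), 1 < q → χ.IsPrimitive → GRH χ →
        ∀ t : ℝ, 2 ≤ t →
          |argS χ t| < 0.804 * (Real.log (q * (t + 1)) / Real.log (Real.log (q * (t + 3))))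
            + C * (Real.log (q * (t + 3)) / (Real.log (Real.log (q * (t + 3)))) ^ 2) := by
  obtain ⟨K, hK, hS⟩ := exists_abs_argS_le
  obtain ⟨C, hC, h⟩ := exists_optimized_bound hK
  refine ⟨C, hC, fun q _ χ hq hχ hG t ht => ?_⟩
  have hq2 : (2 : ℝ) ≤ q := by exact_mod_cast hq
  exact h _ _ _ (two_le_log hq2 ht) (log_mul_sub_one_le hq2 ht) (abs_nonneg _)
    fun u hu => hS q χ hq hχ hG t ht u hu
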